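/- With n = n_k = 2^k k and X̃(k,k) = X(k,k)/2, the second moment satisfies lim_{k→∞} E[ X̃(k,k)² ] = 1/(4π) + 1/(16π²); equivalently, E[ X̃(k,k)² ] = E X̃(k,k) + (E X̃(k,k))²·(1 + o(1)) + o(1) as k → ∞. -/

import Mathlib

open Filter Real

/-- A "configuration" in a graph `G`: two disjoint nonempty cliques `X₁, X₂` with no
edges between them, together with a vertex `x` outside both that is adjacent to every
vertex of `X₁ ∪ X₂`, such that every vertex outside `X₁ ∪ X₂` has a neighbor in `X₁`
and a neighbor in `X₂`. -/
def IsConfig {n : ℕ} (G : SimpleGraph (Fin n)) (X₁ X₂ : Finset (Fin n)) (x : Fin n) : Prop :=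
  X₁.Nonempty ∧ X₂.Nonempty ∧ Disjoint X₁ X₂ ∧
  x ∉ X₁ ∧ x ∉ X₂ ∧
  (∀ u ∈ X₁, ∀ v ∈ X₁, u ≠ v → G.Adj u v) ∧
  (∀ u ∈ X₂, ∀ v ∈ X₂, u ≠ v → G.Adj u v) ∧
  (∀ u ∈ X₁, ∀ v ∈ X₂, ¬ G.Adj u v) ∧
  (∀ u ∈ X₁, G.Adj x u) ∧ (∀ u ∈ X₂, G.Adj x u) ∧
  (∀ y : Fin n, y ∉ X₁ → y ∉ X₂ →
    (∃ u ∈ X₁, G.Adj y u) ∧ (∃ u ∈ X₂, G.Adj y u))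

/-- Property `P` of a graph: existence of a configuration. -/
def PropertyP {n : ℕ} (G : SimpleGraph (Fin n)) : Prop :=
  ∃ (X₁ X₂ : Finset (Fin n)) (x : Fin n), IsConfig G X₁ X₂ x

/-- The probability, under the uniform distribution on graphs on `{1, …, n}`,
of the set of graphs satisfying `Q`. -/
noncomputable def unifProb (n : ℕ) (Q : SimpleGraph (Fin n) → Prop) : ℝ :=
  (Nat.card {G : SimpleGraph (Fin n) // Q G} : ℝ) / 2 ^ (n.choose 2)

/-- `Xcount n k l G` is the number of ordered triples `(X₁, X₂, x)` forming a
configuration in `G` with `|X₁| = k` and `|X₂| = l`. -/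
noncomputable def Xcount (n k l : ℕ) (G : SimpleGraph (Fin n)) : ℕ :=
  Nat.card {t : Finset (Fin n) × Finset (Fin n) × Fin n //
    t.1.card = k ∧ t.2.1.card = l ∧ IsConfig G t.1 t.2.1 t.2.2}

/-- The expectation of a random variable `Y` under the uniform distribution on graphs
on `{1, …, n}`. -/
noncomputable def expect (n : ℕ) (Y : SimpleGraph (Fin n) → ℝ) : ℝ :=
  (∑ G : SimpleGraph (Fin n), Y G) / 2 ^ (n.choose 2)

section BoolCube

open scoped Classical

/-- The average of a function on the cube `ι → Bool`. -/
noncomputable def cubeMean {ι : Type*} [Fintype ι] (f : (ι → Bool) → ℝ) : ℝ :=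
  (∑ ω, f ω) / 2 ^ Fintype.card ι

/-- The uniform probability of an event on the cube `ι → Bool`. -/
noncomputable def cubeProb {ι : Type*} [Fintype ι] (p : (ι → Bool) → Prop) : ℝ :=
  cubeMean fun ω => if p ω then 1 else 0

variable {ι : Type*} [Fintype ι]

theorem cubeMean_mono {f g : (ι → Bool) → ℝ} (h : ∀ ω, f ω ≤ g ω) : cubeMean f ≤ cubeMean g := by
  unfold cubeMean
  gcongr with ω
  exact h ω

theorem cubeMean_const (c : ℝ) : cubeMean (fun _ : ι → Bool => c) = c := by
  simp [cubeMean]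

theorem cubeMean_add (f g : (ι → Bool) → ℝ) :
    cubeMean (fun ω => f ω + g ω) = cubeMean f + cubeMean g := by
  simp [cubeMean, Finset.sum_add_distrib, add_div]

theorem cubeMean_sub (f g : (ι → Bool) → ℝ) :
    cubeMean (fun ω => f ω - g ω) = cubeMean f - cubeMean g := by
  simp [cubeMean, Finset.sum_sub_distrib, sub_div]

theorem cubeMean_sum {α : Type*} (s : Finset α) (f : α → (ι → Bool) → ℝ) :
    cubeMean (fun ω => ∑ a ∈ s, f a ω) = ∑ a ∈ s, cubeMean (f a) := by
  simp only [cubeMean]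
  rw [Finset.sum_comm, Finset.sum_div]

theorem cubeProb_nonneg (p : (ι → Bool) → Prop) : 0 ≤ cubeProb p := by
  have h := cubeMean_mono (ι := ι) (f := fun _ => 0) (g := fun ω => if p ω then 1 else 0)
    fun ω => by positivity
  rwa [cubeMean_const] at h

theorem cubeProb_mono {p q : (ι → Bool) → Prop} (h : ∀ ω, p ω → q ω) :
    cubeProb p ≤ cubeProb q := by
  refine cubeMean_mono fun ω => ?_
  by_cases hp : p ω
  · simp [hp, h ω hp]
  · simp only [hp, if_false]
    split_ifs <;> norm_num

theorem cubeProb_congr {p q : (ι → Bool) → Prop} (h : ∀ ω, p ω ↔ q ω) :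
    cubeProb p = cubeProb q := by
  exact congrArg cubeProb (funext fun ω => propext (h ω))

theorem cubeProb_eq_zero {p : (ι → Bool) → Prop} (h : ∀ ω, ¬ p ω) : cubeProb p = 0 := by
  simp [cubeProb, h, cubeMean]

theorem cubeProb_not (p : (ι → Bool) → Prop) : cubeProb (fun ω => ¬ p ω) = 1 - cubeProb p := by
  have h := cubeMean_sub (ι := ι) (fun _ => 1) fun ω => if p ω then 1 else 0
  rw [cubeMean_const] at h
  rw [cubeProb, cubeProb, ← h]
  refine congrArg cubeMean (funext fun ω => ?_)
  by_cases hp : p ω <;> simp [hp]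

theorem cubeProb_exists_le {α : Type*} (s : Finset α) (p : α → (ι → Bool) → Prop) :
    cubeProb (fun ω => ∃ a ∈ s, p a ω) ≤ ∑ a ∈ s, cubeProb (p a) := by
  simp only [cubeProb]
  rw [← cubeMean_sum]
  refine cubeMean_mono fun ω => ?_
  split_ifs with h
  · obtain ⟨a, ha, hp⟩ := h
    calc (1 : ℝ) = if p a ω then 1 else 0 := by simp [hp]
      _ ≤ _ := Finset.single_le_sum (f := fun a => if p a ω then (1 : ℝ) else 0)
        (fun i _ => by split_ifs <;> norm_num) ha
  · exact Finset.sum_nonneg fun i _ => by split_ifs <;> norm_num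

/-- Functions depending on disjoint sets of coordinates are independent. -/
theorem cubeMean_mul {f g : (ι → Bool) → ℝ} {S T : Set ι} (hf : DependsOn f S)
    (hg : DependsOn g T) (hST : Disjoint S T) :
    cubeMean (fun ω => f ω * g ω) = cubeMean f * cubeMean g := by
  have hswap : Function.Involutive (fun z : (ι → Bool) × (ι → Bool) =>
      (S.piecewise z.1 z.2, S.piecewise z.2 z.1)) := by
    rintro ⟨a, b⟩
    ext i <;> by_cases hi : i ∈ S <;> simp [hi]
  have key : (∑ ω, f ω) * ∑ ω, g ω =
      ∑ z : (ι → Bool) × (ι → Bool), f z.1 * g z.1 := by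
    rw [Finset.sum_mul_sum, ← Fintype.sum_prod_type', ← Equiv.sum_comp hswap.toPerm]
    refine Finset.sum_congr rfl fun z _ => ?_
    congr 1
    · refine hf fun i hi => ?_
      simp [Function.Involutive.toPerm, hi]
    · refine hg fun i hi => ?_
      have : i ∉ S := fun h => Set.disjoint_left.mp hST h hi
      simp [Function.Involutive.toPerm, this]
  have hcard : ∑ z : (ι → Bool) × (ι → Bool), f z.1 * g z.1 =
      2 ^ Fintype.card ι * ∑ ω, f ω * g ω := by
    rw [Fintype.sum_prod_type]
    simp [Finset.mul_sum]
  simp only [cubeMean]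
  rw [div_mul_div_comm, key, hcard]
  field_simp

/-- Events depending on disjoint sets of coordinates are independent. -/
theorem cubeProb_and {p q : (ι → Bool) → Prop} {S T : Set ι} (hp : DependsOn p S)
    (hq : DependsOn q T) (hST : Disjoint S T) :
    cubeProb (fun ω => p ω ∧ q ω) = cubeProb p * cubeProb q := by
  rw [cubeProb, cubeProb, cubeProb, ← cubeMean_mul (S := S) (T := T) _ _ hST]
  · congr 1
    ext ω
    by_cases h : p ω <;> simp [h]
  · intro x y h
    simp [hp h]
  · intro x y h
    simp [hq h]

theorem DependsOn.forall_mem {ι α : Type*} {s : Finset α} {p : α → (ι → Bool) → Prop}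
    {S : α → Set ι} (hp : ∀ a ∈ s, DependsOn (p a) (S a)) :
    DependsOn (fun ω => ∀ a ∈ s, p a ω) (⋃ a ∈ s, S a) := by
  intro x y h
  refine propext (forall₂_congr fun a ha => ?_)
  rw [hp a ha fun i hi => h i (Set.mem_biUnion ha hi)]

theorem cubeProb_forall {α : Type*} (s : Finset α) {p : α → (ι → Bool) → Prop}
    {S : α → Set ι} (hp : ∀ a ∈ s, DependsOn (p a) (S a))
    (hS : ∀ a ∈ s, ∀ b ∈ s, a ≠ b → Disjoint (S a) (S b)) :
    cubeProb (fun ω => ∀ a ∈ s, p a ω) = ∏ a ∈ s, cubeProb (p a) := by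
  induction s using Finset.induction_on with
  | empty => simp [cubeProb, cubeMean_const]
  | insert a s ha ih =>
    rw [Finset.prod_insert ha, ← ih (fun b hb => hp b (Finset.mem_insert_of_mem hb))
      (fun b hb c hc => hS b (Finset.mem_insert_of_mem hb) c (Finset.mem_insert_of_mem hc)),
      ← cubeProb_and (hp a (Finset.mem_insert_self a s))
        (DependsOn.forall_mem fun b hb => hp b (Finset.mem_insert_of_mem hb))]
    · exact cubeProb_congr fun ω => by simp
    · rw [Set.disjoint_iUnion₂_right]
      exact fun b hb => hS a (Finset.mem_insert_self a s) b (Finset.mem_insert_of_mem hb)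
        (by rintro rfl; exact ha hb)

theorem cubeProb_eq_card (p : (ι → Bool) → Prop) :
    cubeProb p = (Finset.univ.filter p).card / 2 ^ Fintype.card ι := by
  rw [cubeProb, cubeMean, Finset.sum_boole]

theorem cubeProb_eqOn (S : Finset ι) (val : ι → Bool) :
    cubeProb (fun ω => ∀ e ∈ S, ω e = val e) = (1 / 2) ^ S.card := by
  rw [cubeProb_eq_card]
  have h : (Finset.univ.filter fun ω : ι → Bool => ∀ e ∈ S, ω e = val e) =
      Fintype.piFinset fun e => if e ∈ S then {val e} else Finset.univ := by
    ext ω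
    simp only [Finset.mem_filter, Finset.mem_univ, true_and, Fintype.mem_piFinset]
    refine forall_congr' fun e => ?_
    split_ifs with he <;> simp [he]
  have hc : (Fintype.piFinset fun e => if e ∈ S then {val e} else Finset.univ).card =
      2 ^ (Fintype.card ι - S.card) := by
    rw [Fintype.card_piFinset, ← Finset.card_compl, ← Finset.prod_const,
      ← Finset.prod_subset (Finset.subset_univ Sᶜ)]
    · refine Finset.prod_congr rfl fun e he => ?_
      rw [if_neg (Finset.mem_compl.mp he)]
      simp
    · intro e _ he
      rw [if_pos (by simpa using he)]
      simp
  convert_to ((2 ^ (Fintype.card ι - S.card) : ℕ) : ℝ) / 2 ^ Fintype.card ι = _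
  · rw [← hc, ← h]
    congr!
  rw [Nat.cast_pow, Nat.cast_ofNat,
    pow_sub₀ _ two_ne_zero (Finset.card_le_univ S)]
  field_simp
  simp

end BoolCube

section RandomGraph

open scoped Classical

variable {n : ℕ}

/-- The graph on `Fin n` whose edges are the pairs selected by `ω`. -/
def cubeGraph (ω : Sym2 (Fin n) → Bool) : SimpleGraph (Fin n) where
  Adj u v := u ≠ v ∧ ω s(u, v) = true
  symm := ⟨fun u v h => ⟨h.1.symm, by rw [Sym2.eq_swap]; exact h.2⟩⟩
  loopless := ⟨fun _ h => h.1 rfl⟩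

/-- The two-element subsets of `s`. -/
def pairsIn (s : Finset (Fin n)) : Finset (Sym2 (Fin n)) :=
  s.offDiag.image fun z => s(z.1, z.2)

theorem card_pairsIn (s : Finset (Fin n)) : (pairsIn s).card = s.card.choose 2 := by
  exact Sym2.card_image_offDiag s

theorem mk_mem_pairsIn {s : Finset (Fin n)} {u v : Fin n} :
    s(u, v) ∈ pairsIn s ↔ u ∈ s ∧ v ∈ s ∧ u ≠ v := by
  simp only [pairsIn, Finset.mem_image, Finset.mem_offDiag, Prod.exists, Sym2.eq_iff]
  constructor
  · rintro ⟨a, b, ⟨ha, hb, hab⟩, ⟨rfl, rfl⟩ | ⟨rfl, rfl⟩⟩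
    exacts [⟨ha, hb, hab⟩, ⟨hb, ha, hab.symm⟩]
  · exact fun h => ⟨u, v, h, Or.inl ⟨rfl, rfl⟩⟩

theorem pairsIn_inter (s t : Finset (Fin n)) : pairsIn s ∩ pairsIn t = pairsIn (s ∩ t) := by
  ext e
  induction e with
  | _ u v => simp only [Finset.mem_inter, mk_mem_pairsIn]; tauto

theorem cubeGraph_eq_iff (ω : Sym2 (Fin n) → Bool) (G : SimpleGraph (Fin n)) :
    cubeGraph ω = G ↔ ∀ e ∈ pairsIn (Finset.univ : Finset (Fin n)), ω e = decide (e ∈ G.edgeSet) := by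
  constructor
  · rintro rfl e he
    induction e with
    | _ u v =>
      rw [mk_mem_pairsIn] at he
      simp [cubeGraph, he.2.2]
  · intro h
    ext u v
    by_cases huv : u = v
    · simp [huv]
    · have := h s(u, v) (by simp [mk_mem_pairsIn, huv])
      simp [cubeGraph, huv, this]

/-- Uniform graphs are obtained by selecting every pair independently with probability `1/2`. -/
theorem expect_eq_cubeMean (Y : SimpleGraph (Fin n) → ℝ) :
    expect n Y = cubeMean fun ω => Y (cubeGraph ω) := by
  have h : ∀ ω : Sym2 (Fin n) → Bool,
      Y (cubeGraph ω) = ∑ G, Y G * if cubeGraph ω = G then 1 else 0 := by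
    intro ω
    simp
  simp_rw [h]
  rw [cubeMean_sum, expect, Finset.sum_div]
  refine Finset.sum_congr rfl fun G _ => ?_
  have hG : cubeProb (fun ω => cubeGraph ω = G) = (1 / 2) ^ n.choose 2 := by
    rw [cubeProb_congr fun ω => cubeGraph_eq_iff ω G, cubeProb_eqOn, card_pairsIn]
    simp
  rw [cubeProb] at hG
  have hmul := cubeMean_mul (ι := Sym2 (Fin n)) (f := fun _ => Y G)
    (g := fun ω => if cubeGraph ω = G then 1 else 0) (S := ∅) (T := Set.univ)
    (fun _ _ _ => rfl) (fun x y hxy => by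
      have : x = y := funext fun i => hxy i trivial
      rw [this]) (Set.empty_disjoint _)
  rw [hmul, cubeMean_const, hG]
  simp [div_eq_mul_inv]

/-- The candidates for configurations with two cliques of size `k`. -/
noncomputable def triples (n k : ℕ) : Finset (Finset (Fin n) × Finset (Fin n) × Fin n) :=
  Finset.univ.filter fun t => t.1.card = k ∧ t.2.1.card = k ∧ Disjoint t.1 t.2.1 ∧
    t.2.2 ∉ t.1 ∧ t.2.2 ∉ t.2.1

/-- All vertices of a candidate. -/
def support (t : Finset (Fin n) × Finset (Fin n) × Fin n) : Finset (Fin n) :=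
  insert t.2.2 (t.1 ∪ t.2.1)

/-- The candidate with its two cliques exchanged. -/
def swapTriple (t : Finset (Fin n) × Finset (Fin n) × Fin n) :
    Finset (Fin n) × Finset (Fin n) × Fin n :=
  (t.2.1, t.1, t.2.2)

/-- The adjacency prescribed by a candidate on its support. -/
noncomputable def pattern (t : Finset (Fin n) × Finset (Fin n) × Fin n) (e : Sym2 (Fin n)) :
    Bool :=
  decide (∀ u ∈ t.1, ∀ v ∈ t.2.1, e ≠ s(u, v))

/-- The selection `ω` follows the pattern of `t` on its support. -/
def Induces (t : Finset (Fin n) × Finset (Fin n) × Fin n) (ω : Sym2 (Fin n) → Bool) : Prop :=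
  ∀ e ∈ pairsIn (support t), ω e = pattern t e

/-- The vertex `v` has a neighbor in `A`. -/
def Touches (A : Finset (Fin n)) (v : Fin n) (ω : Sym2 (Fin n) → Bool) : Prop :=
  ∃ u ∈ A, ω s(v, u) = true

/-- The candidate `t` is a configuration of the graph selected by `ω`. -/
def Occurs (t : Finset (Fin n) × Finset (Fin n) × Fin n) (ω : Sym2 (Fin n) → Bool) : Prop :=
  IsConfig (cubeGraph ω) t.1 t.2.1 t.2.2

variable {k : ℕ} {t : Finset (Fin n) × Finset (Fin n) × Fin n}

theorem mem_triples : t ∈ triples n k ↔ t.1.card = k ∧ t.2.1.card = k ∧ Disjoint t.1 t.2.1 ∧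
    t.2.2 ∉ t.1 ∧ t.2.2 ∉ t.2.1 := by
  simp [triples]

theorem mem_support {v : Fin n} : v ∈ support t ↔ v = t.2.2 ∨ v ∈ t.1 ∨ v ∈ t.2.1 := by
  simp [support]

theorem card_support (ht : t ∈ triples n k) : (support t).card = 2 * k + 1 := by
  obtain ⟨h1, h2, hd, hx1, hx2⟩ := mem_triples.mp ht
  rw [support, Finset.card_insert_of_notMem (by simp [hx1, hx2]), Finset.card_union_of_disjoint hd,
    h1, h2, two_mul]

theorem swapTriple_mem (ht : t ∈ triples n k) : swapTriple t ∈ triples n k := by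
  obtain ⟨h1, h2, hd, hx1, hx2⟩ := mem_triples.mp ht
  exact mem_triples.mpr ⟨h2, h1, hd.symm, hx2, hx1⟩

theorem swapTriple_ne (hk : 0 < k) (ht : t ∈ triples n k) : swapTriple t ≠ t := by
  obtain ⟨h1, h2, hd, hx1, hx2⟩ := mem_triples.mp ht
  intro h
  have h12 : t.2.1 = t.1 := congrArg Prod.fst h
  rw [h12, disjoint_self] at hd
  rw [hd, Finset.bot_eq_empty, Finset.card_empty] at h1
  omega

theorem occurs_swapTriple (ω : Sym2 (Fin n) → Bool) : Occurs (swapTriple t) ω ↔ Occurs t ω := by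
  have key : ∀ (G : SimpleGraph (Fin n)) (A B : Finset (Fin n)) (x : Fin n),
      IsConfig G A B x → IsConfig G B A x := by
    rintro G A B x ⟨h1, h2, h3, h4, h5, h6, h7, h8, h9, h10, h11⟩
    exact ⟨h2, h1, h3.symm, h5, h4, h7, h6, fun u hu v hv h => h8 v hv u hu h.symm, h10, h9,
      fun y hy hy' => (h11 y hy' hy).symm⟩
  exact ⟨key _ _ _ _, key _ _ _ _⟩

theorem pattern_cross {u v : Fin n} (hu : u ∈ t.1) (hv : v ∈ t.2.1) :
    pattern t s(u, v) = false := by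
  simp only [pattern, decide_eq_false_iff_not]
  exact fun h => h u hu v hv rfl

theorem pattern_mk_eq_true {u v : Fin n} :
    pattern t s(u, v) = true ↔ ¬ (u ∈ t.1 ∧ v ∈ t.2.1) ∧ ¬ (v ∈ t.1 ∧ u ∈ t.2.1) := by
  simp only [pattern, decide_eq_true_eq, ne_eq, Sym2.eq_iff]
  constructor
  · exact fun h => ⟨fun ⟨h1, h2⟩ => h u h1 v h2 (Or.inl ⟨rfl, rfl⟩),
      fun ⟨h1, h2⟩ => h v h1 u h2 (Or.inr ⟨rfl, rfl⟩)⟩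
  · rintro ⟨h1, h2⟩ a ha b hb (⟨rfl, rfl⟩ | ⟨rfl, rfl⟩)
    exacts [h1 ⟨ha, hb⟩, h2 ⟨ha, hb⟩]

theorem occurs_iff (hk : 0 < k) (ht : t ∈ triples n k) (ω : Sym2 (Fin n) → Bool) :
    Occurs t ω ↔ Induces t ω ∧
      ∀ v ∈ (support t)ᶜ, Touches t.1 v ω ∧ Touches t.2.1 v ω := by
  obtain ⟨h1, h2, hd, hx1, hx2⟩ := mem_triples.mp ht
  have hn1 : t.1.Nonempty := Finset.card_pos.mp (by omega)
  have hn2 : t.2.1.Nonempty := Finset.card_pos.mp (by omega)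
  have hd' : ∀ a, a ∈ t.1 → a ∉ t.2.1 := fun _ h => Finset.disjoint_left.mp hd h
  constructor
  · rintro ⟨-, -, -, -, -, hA, hB, hAB, hxA, hxB, hdom⟩
    refine ⟨fun e he => ?_, fun v hv => ?_⟩
    · induction e with
      | _ u v =>
        obtain ⟨hu, hv, huv⟩ := mk_mem_pairsIn.mp he
        rw [Bool.eq_iff_iff, pattern_mk_eq_true]
        rw [mem_support] at hu hv
        have hadj : ω s(u, v) = true ↔ (cubeGraph ω).Adj u v := by simp [cubeGraph, huv]
        rw [hadj]
        rcases hu with rfl | hu | hu <;> rcases hv with rfl | hv | hv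
        · exact absurd rfl huv
        · exact iff_of_true (hxA _ hv) ⟨fun h => hx1 h.1, fun h => hx2 h.2⟩
        · exact iff_of_true (hxB _ hv) ⟨fun h => hx1 h.1, fun h => hx2 h.2⟩
        · exact iff_of_true (hxA _ hu).symm ⟨fun h => hx2 h.2, fun h => hx1 h.1⟩
        · exact iff_of_true (hA _ hu _ hv huv) ⟨fun h => hd' _ hv h.2, fun h => hd' _ hu h.2⟩
        · exact iff_of_false (hAB _ hu _ hv) fun h => h.1 ⟨hu, hv⟩
        · exact iff_of_true (hxB _ hu).symm ⟨fun h => hx2 h.2, fun h => hx1 h.1⟩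
        · exact iff_of_false (fun h => hAB _ hv _ hu h.symm) fun h => h.2 ⟨hv, hu⟩
        · exact iff_of_true (hB _ hu _ hv huv) ⟨fun h => hd' _ h.1 hu, fun h => hd' _ h.1 hv⟩
    · rw [Finset.mem_compl, mem_support, not_or, not_or] at hv
      obtain ⟨⟨a, ha, ha'⟩, b, hb, hb'⟩ := hdom v hv.2.1 hv.2.2
      exact ⟨⟨a, ha, ha'.2⟩, b, hb, hb'.2⟩
  · rintro ⟨hI, hT⟩
    have hval : ∀ u ∈ support t, ∀ v ∈ support t, u ≠ v →
        ((cubeGraph ω).Adj u v ↔ ¬ (u ∈ t.1 ∧ v ∈ t.2.1) ∧ ¬ (v ∈ t.1 ∧ u ∈ t.2.1)) := by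
      intro u hu v hv huv
      rw [← pattern_mk_eq_true, ← hI _ (mk_mem_pairsIn.mpr ⟨hu, hv, huv⟩)]
      simp [cubeGraph, huv]
    have m1 : ∀ u ∈ t.1, u ∈ support t := fun u hu => mem_support.mpr (Or.inr (Or.inl hu))
    have m2 : ∀ u ∈ t.2.1, u ∈ support t := fun u hu => mem_support.mpr (Or.inr (Or.inr hu))
    have m3 : t.2.2 ∈ support t := mem_support.mpr (Or.inl rfl)
    have hxA : ∀ u ∈ t.1, (cubeGraph ω).Adj t.2.2 u := fun u hu =>
      (hval _ m3 _ (m1 u hu) (by rintro h; exact hx1 (h ▸ hu))).mpr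
        ⟨fun h => hx1 h.1, fun h => hx2 h.2⟩
    have hxB : ∀ u ∈ t.2.1, (cubeGraph ω).Adj t.2.2 u := fun u hu =>
      (hval _ m3 _ (m2 u hu) (by rintro h; exact hx2 (h ▸ hu))).mpr
        ⟨fun h => hx1 h.1, fun h => hx2 h.2⟩
    refine ⟨hn1, hn2, hd, hx1, hx2, ?_, ?_, ?_, hxA, hxB, ?_⟩
    · exact fun u hu v hv huv => (hval u (m1 u hu) v (m1 v hv) huv).mpr
        ⟨fun h => hd' _ hv h.2, fun h => hd' _ hu h.2⟩
    · exact fun u hu v hv huv => (hval u (m2 u hu) v (m2 v hv) huv).mpr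
        ⟨fun h => hd' _ h.1 hu, fun h => hd' _ h.1 hv⟩
    · intro u hu v hv h
      exact ((hval u (m1 u hu) v (m2 v hv) h.ne).mp h).1 ⟨hu, hv⟩
    · intro y hy1 hy2
      by_cases hyx : y = t.2.2
      · rw [hyx]
        exact ⟨hn1.imp fun a ha => ⟨ha, hxA a ha⟩, hn2.imp fun a ha => ⟨ha, hxB a ha⟩⟩
      · obtain ⟨⟨a, ha, ha'⟩, b, hb, hb'⟩ := hT y (by
          rw [Finset.mem_compl, mem_support, not_or, not_or]
          exact ⟨hyx, hy1, hy2⟩)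
        exact ⟨⟨a, ha, by rintro rfl; exact hy1 ha, ha'⟩, b, hb, by rintro rfl; exact hy2 hb, hb'⟩

theorem Xcount_cubeGraph (n k : ℕ) (ω : Sym2 (Fin n) → Bool) :
    (Xcount n k k (cubeGraph ω) : ℝ) = ∑ t ∈ triples n k, if Occurs t ω then 1 else 0 := by
  rw [Finset.sum_boole, Xcount, Nat.card_eq_fintype_card, Fintype.card_subtype]
  congr 2
  ext t
  rw [Finset.mem_filter, Finset.mem_filter, mem_triples]
  constructor
  · rintro ⟨-, h1, h2, h⟩
    exact ⟨⟨h1, h2, h.2.2.1, h.2.2.2.1, h.2.2.2.2.1⟩, h⟩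
  · rintro ⟨⟨h1, h2, -⟩, h⟩
    exact ⟨Finset.mem_univ _, h1, h2, h⟩

theorem expect_sq (n k : ℕ) :
    expect n (fun G => ((Xcount n k k G : ℝ) / 2) ^ 2) =
      1 / 4 * ∑ t ∈ triples n k, ∑ s ∈ triples n k, cubeProb fun ω => Occurs t ω ∧ Occurs s ω := by
  have h : ∀ ω : Sym2 (Fin n) → Bool, ((Xcount n k k (cubeGraph ω) : ℝ) / 2) ^ 2 =
      ∑ t ∈ triples n k, ∑ s ∈ triples n k,
        1 / 4 * if Occurs t ω ∧ Occurs s ω then (1 : ℝ) else 0 := by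
    intro ω
    rw [Xcount_cubeGraph, div_pow, sq, Finset.sum_mul_sum, Finset.sum_div]
    refine Finset.sum_congr rfl fun t _ => ?_
    rw [Finset.sum_div]
    refine Finset.sum_congr rfl fun s _ => ?_
    by_cases h1 : Occurs t ω <;> by_cases h2 : Occurs s ω <;> norm_num [h1, h2]
  rw [expect_eq_cubeMean]
  simp_rw [h]
  rw [cubeMean_sum, Finset.mul_sum]
  refine Finset.sum_congr rfl fun t _ => ?_
  rw [cubeMean_sum, Finset.mul_sum]
  refine Finset.sum_congr rfl fun s _ => ?_
  simp only [cubeProb, cubeMean, ← Finset.mul_sum]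
  rw [mul_div_assoc]
  congr!

end RandomGraph

section PairProbabilities

open scoped Classical

theorem cubeProb_or_le {ι : Type*} [Fintype ι] (p q : (ι → Bool) → Prop) :
    cubeProb (fun ω => p ω ∨ q ω) ≤ cubeProb p + cubeProb q := by
  rw [cubeProb, cubeProb, cubeProb, ← cubeMean_add]
  refine cubeMean_mono fun ω => ?_
  by_cases hp : p ω <;> by_cases hq : q ω <;> simp [hp, hq]

theorem DependsOn.and_prop {ι : Type*} {p q : (ι → Bool) → Prop} {S T : Set ι}
    (hp : DependsOn p S) (hq : DependsOn q T) : DependsOn (fun ω => p ω ∧ q ω) (S ∪ T) := by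
  intro x y h
  simp only [hp fun i hi => h i (Or.inl hi), hq fun i hi => h i (Or.inr hi)]

theorem DependsOn.mono_set {ι : Type*} {p : (ι → Bool) → Prop} {S T : Set ι}
    (hp : DependsOn p S) (h : S ⊆ T) : DependsOn p T :=
  fun _ _ hxy => hp fun i hi => hxy i (h hi)

variable {n : ℕ}

/-- The pairs joining `v` to the elements of `A`. -/
def starTo (v : Fin n) (A : Finset (Fin n)) : Finset (Sym2 (Fin n)) :=
  A.image fun a => s(v, a)

theorem mem_starTo {v a b : Fin n} {A : Finset (Fin n)} :
    s(a, b) ∈ starTo v A ↔ (a = v ∧ b ∈ A) ∨ (b = v ∧ a ∈ A) := by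
  simp only [starTo, Finset.mem_image, Sym2.eq_iff]
  constructor
  · rintro ⟨c, hc, ⟨rfl, rfl⟩ | ⟨rfl, rfl⟩⟩
    exacts [Or.inl ⟨rfl, hc⟩, Or.inr ⟨rfl, hc⟩]
  · rintro (⟨rfl, h⟩ | ⟨rfl, h⟩)
    exacts [⟨b, h, Or.inl ⟨rfl, rfl⟩⟩, ⟨a, h, Or.inr ⟨rfl, rfl⟩⟩]

theorem card_starTo (v : Fin n) (A : Finset (Fin n)) : (starTo v A).card = A.card :=
  Finset.card_image_of_injective _ fun _ _ h => Sym2.congr_right.mp h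

theorem starTo_mono (v : Fin n) {A B : Finset (Fin n)} (h : A ⊆ B) :
    (starTo v A : Set (Sym2 (Fin n))) ⊆ starTo v B :=
  Finset.coe_subset.mpr (Finset.image_subset_image h)

theorem starTo_disjoint_of_disjoint (v : Fin n) {A B : Finset (Fin n)} (h : Disjoint A B) :
    Disjoint (starTo v A : Set (Sym2 (Fin n))) (starTo v B) := by
  rw [Finset.disjoint_coe]
  exact (Finset.disjoint_image fun _ _ h => Sym2.congr_right.mp h).mpr h

theorem starTo_disjoint_starTo {U : Finset (Fin n)} {v w : Fin n} (hv : v ∉ U) (hvw : v ≠ w) :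
    Disjoint (starTo v U : Set (Sym2 (Fin n))) (starTo w U) := by
  rw [Finset.disjoint_coe, Finset.disjoint_left]
  intro e
  induction e with
  | _ a b =>
    rw [mem_starTo, mem_starTo]
    rintro (⟨rfl, -⟩ | ⟨rfl, -⟩) (⟨h', h''⟩ | ⟨h', h''⟩)
    exacts [hvw h', hv h'', hv h'', hvw h']

theorem pairsIn_disjoint_starTo {U : Finset (Fin n)} {v : Fin n} (hv : v ∉ U) :
    Disjoint (pairsIn U : Set (Sym2 (Fin n))) (starTo v U) := by
  rw [Finset.disjoint_coe, Finset.disjoint_left]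
  intro e
  induction e with
  | _ a b =>
    rw [mem_starTo, mk_mem_pairsIn]
    rintro ⟨ha, hb, -⟩ (⟨rfl, -⟩ | ⟨rfl, -⟩)
    exacts [hv ha, hv hb]

theorem pairsIn_mono {s t : Finset (Fin n)} (h : s ⊆ t) :
    (pairsIn s : Set (Sym2 (Fin n))) ⊆ pairsIn t :=
  Finset.coe_subset.mpr (Finset.image_subset_image (Finset.offDiag_mono h))

theorem touches_dependsOn (A : Finset (Fin n)) (v : Fin n) : DependsOn (Touches A v) (starTo v A) := by
  intro x y h
  refine propext (exists_congr fun a => and_congr_right fun ha => ?_)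
  rw [h _ (Finset.mem_coe.mpr (Finset.mem_image_of_mem _ ha))]

theorem cubeProb_not_touches (A : Finset (Fin n)) (v : Fin n) :
    cubeProb (fun ω => ¬ Touches A v ω) = (1 / 2) ^ A.card := by
  rw [← card_starTo v A, ← cubeProb_eqOn (starTo v A) fun _ => false]
  refine cubeProb_congr fun ω => ?_
  simp [Touches, starTo]

theorem cubeProb_touches (A : Finset (Fin n)) (v : Fin n) :
    cubeProb (Touches A v) = 1 - (1 / 2) ^ A.card := by
  rw [← cubeProb_not_touches A v, cubeProb_not]
  ring

theorem cubeProb_touches_two {A B : Finset (Fin n)} (h : Disjoint A B) (v : Fin n) :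
    cubeProb (fun ω => Touches A v ω ∧ Touches B v ω) =
      (1 - (1 / 2) ^ A.card) * (1 - (1 / 2) ^ B.card) := by
  rw [cubeProb_and (touches_dependsOn A v) (touches_dependsOn B v) (starTo_disjoint_of_disjoint v h),
    cubeProb_touches, cubeProb_touches]

theorem touches_two_dependsOn {A B U : Finset (Fin n)} (v : Fin n) (hA : A ⊆ U) (hB : B ⊆ U) :
    DependsOn (fun ω => Touches A v ω ∧ Touches B v ω) (starTo v U) :=
  ((touches_dependsOn A v).and_prop (touches_dependsOn B v)).mono_set
    (Set.union_subset (starTo_mono v hA) (starTo_mono v hB))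

/-- Bonferroni bound for a vertex having neighbors in each of four sets. -/
theorem cubeProb_touches_four_le {k j : ℕ} {A B C D : Finset (Fin n)} (v : Fin n)
    (hA : A.card = k) (hB : B.card = k) (hC : C.card = k) (hD : D.card = k)
    (hAB : (A ∩ B).card ≤ j) (hAC : (A ∩ C).card ≤ j) (hAD : (A ∩ D).card ≤ j)
    (hBC : (B ∩ C).card ≤ j) (hBD : (B ∩ D).card ≤ j) (hCD : (C ∩ D).card ≤ j) :
    cubeProb (fun ω => (Touches A v ω ∧ Touches B v ω) ∧ Touches C v ω ∧ Touches D v ω) ≤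
      1 - 4 * (1 / 2) ^ k + 6 * (((1 / 2) ^ k) ^ 2 * 2 ^ j) := by
  have pair : ∀ {E F : Finset (Fin n)}, E.card = k → F.card = k → (E ∩ F).card ≤ j →
      cubeProb (fun ω => ¬ Touches (E ∪ F) v ω) ≤ ((1 / 2) ^ k) ^ 2 * 2 ^ j := by
    intro E F hE hF hEF
    rw [cubeProb_not_touches]
    have hcard := Finset.card_union_add_card_inter E F
    have h1 : ((1 / 2 : ℝ) ^ k) ^ 2 * 2 ^ (E ∩ F).card = (1 / 2) ^ (E ∪ F).card := by
      rw [← pow_mul, mul_two, ← hE, show E.card + E.card = (E ∪ F).card + (E ∩ F).card by omega,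
        pow_add, mul_assoc, ← mul_pow]
      norm_num
    rw [← h1]
    gcongr
    norm_num
  have hunion : ∀ (E F : Finset (Fin n)) (ω : Sym2 (Fin n) → Bool),
      Touches (E ∪ F) v ω ↔ Touches E v ω ∨ Touches F v ω := by
    intro E F ω
    simp only [Touches, Finset.mem_union, or_and_right, exists_or]
  have key : cubeProb (fun ω => (Touches A v ω ∧ Touches B v ω) ∧ Touches C v ω ∧ Touches D v ω) +
      (cubeProb (fun ω => ¬ Touches A v ω) + cubeProb (fun ω => ¬ Touches B v ω) +
        cubeProb (fun ω => ¬ Touches C v ω) + cubeProb (fun ω => ¬ Touches D v ω)) ≤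
      1 + (cubeProb (fun ω => ¬ Touches (A ∪ B) v ω) + cubeProb (fun ω => ¬ Touches (A ∪ C) v ω) +
        cubeProb (fun ω => ¬ Touches (A ∪ D) v ω) + cubeProb (fun ω => ¬ Touches (B ∪ C) v ω) +
        cubeProb (fun ω => ¬ Touches (B ∪ D) v ω) + cubeProb (fun ω => ¬ Touches (C ∪ D) v ω)) := by
    rw [← cubeMean_const (ι := Sym2 (Fin n)) 1]
    simp only [cubeProb, ← cubeMean_add]
    refine cubeMean_mono fun ω => ?_
    simp only [hunion]
    by_cases a : Touches A v ω <;> by_cases b : Touches B v ω <;>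
      by_cases c : Touches C v ω <;> by_cases d : Touches D v ω <;> norm_num [a, b, c, d]
  simp only [cubeProb_not_touches A, cubeProb_not_touches B, cubeProb_not_touches C,
    cubeProb_not_touches D, hA, hB, hC, hD] at key
  linarith [pair hA hB hAB, pair hA hC hAC, pair hA hD hAD, pair hB hC hBC, pair hB hD hBD,
    pair hC hD hCD]

/-- Events inside `U` and events on the stars from the outside vertices to `U` are independent. -/
theorem cubeProb_inside_and_outside {U : Finset (Fin n)} {p : (Sym2 (Fin n) → Bool) → Prop}
    {b : Fin n → (Sym2 (Fin n) → Bool) → Prop} (hp : DependsOn p (pairsIn U))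
    (hb : ∀ v, DependsOn (b v) (starTo v U)) :
    cubeProb (fun ω => p ω ∧ ∀ v ∈ Uᶜ, b v ω) = cubeProb p * ∏ v ∈ Uᶜ, cubeProb (b v) := by
  rw [cubeProb_and hp (DependsOn.forall_mem fun v (_ : v ∈ Uᶜ) => hb v),
    cubeProb_forall _ fun v (_ : v ∈ Uᶜ) => hb v]
  · exact fun v hv w _ hvw => starTo_disjoint_starTo (Finset.mem_compl.mp hv) hvw
  · rw [Set.disjoint_iUnion₂_right]
    exact fun v hv => pairsIn_disjoint_starTo (Finset.mem_compl.mp hv)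

variable {k : ℕ} {t s : Finset (Fin n) × Finset (Fin n) × Fin n}

theorem left_subset_support : t.1 ⊆ support t := fun _ h => mem_support.mpr (Or.inr (Or.inl h))

theorem right_subset_support : t.2.1 ⊆ support t := fun _ h => mem_support.mpr (Or.inr (Or.inr h))

theorem induces_dependsOn (t : Finset (Fin n) × Finset (Fin n) × Fin n) :
    DependsOn (Induces t) (pairsIn (support t)) := by
  intro x y h
  refine propext (forall₂_congr fun e he => ?_)
  rw [h e he]

theorem cubeProb_induces (ht : t ∈ triples n k) :
    cubeProb (Induces t) = (1 / 2) ^ (2 * k + 1).choose 2 := by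
  rw [← card_support ht, ← card_pairsIn]
  exact cubeProb_eqOn _ _

theorem cubeProb_occurs (hk : 0 < k) (ht : t ∈ triples n k) :
    cubeProb (Occurs t) =
      (1 / 2) ^ (2 * k + 1).choose 2 * ((1 - (1 / 2) ^ k) ^ 2) ^ (n - (2 * k + 1)) := by
  rw [cubeProb_congr (occurs_iff hk ht), cubeProb_inside_and_outside (induces_dependsOn t)
    fun v => touches_two_dependsOn v left_subset_support right_subset_support, cubeProb_induces ht]
  obtain ⟨h1, h2, hd, -, -⟩ := mem_triples.mp ht
  simp_rw [cubeProb_touches_two hd, h1, h2, Finset.prod_const, Finset.card_compl,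
    card_support ht, Fintype.card_fin, sq]

theorem cubeProb_induces_two_le (ht : t ∈ triples n k) (hs : s ∈ triples n k) :
    cubeProb (fun ω => Induces t ω ∧ Induces s ω) ≤
      (1 / 2) ^ (2 * (2 * k + 1).choose 2 - (support t ∩ support s).card.choose 2) := by
  have hcard := Finset.card_union_add_card_inter (pairsIn (support t)) (pairsIn (support s))
  rw [pairsIn_inter, card_pairsIn, card_pairsIn, card_pairsIn, card_support ht,
    card_support hs] at hcard
  rw [show 2 * (2 * k + 1).choose 2 - (support t ∩ support s).card.choose 2 =
      (pairsIn (support t) ∪ pairsIn (support s)).card by omega,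
    ← cubeProb_eqOn _ fun e => if e ∈ pairsIn (support t) then pattern t e else pattern s e]
  refine cubeProb_mono fun ω h e he => ?_
  split_ifs with h'
  · exact h.1 e h'
  · exact h.2 e ((Finset.mem_union.mp he).resolve_left h')

theorem card_compl_union_ge (ht : t ∈ triples n k) (hs : s ∈ triples n k) :
    n - 2 * (2 * k + 1) ≤ (support t ∪ support s)ᶜ.card := by
  have := Finset.card_union_le (support t) (support s)
  rw [card_support ht, card_support hs] at this
  rw [Finset.card_compl, Fintype.card_fin]
  omega

theorem induces_two_dependsOn : DependsOn (fun ω => Induces t ω ∧ Induces s ω)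
    (pairsIn (support t ∪ support s) : Set (Sym2 (Fin n))) :=
  ((induces_dependsOn t).and_prop (induces_dependsOn s)).mono_set
    (Set.union_subset (pairsIn_mono Finset.subset_union_left)
      (pairsIn_mono Finset.subset_union_right))

theorem one_half_pow_le_one (k : ℕ) : (1 / 2 : ℝ) ^ k ≤ 1 :=
  pow_le_one₀ (by norm_num) (by norm_num)

theorem cubeProb_occurs_two_le_coarse (hk : 0 < k) (ht : t ∈ triples n k) (hs : s ∈ triples n k) :
    cubeProb (fun ω => Occurs t ω ∧ Occurs s ω) ≤
      (1 / 2) ^ (2 * (2 * k + 1).choose 2 - (support t ∩ support s).card.choose 2) *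
        ((1 - (1 / 2) ^ k) ^ 2) ^ (n - 2 * (2 * k + 1)) := by
  obtain ⟨h1, h2, hd, -, -⟩ := mem_triples.mp ht
  have hq := one_half_pow_le_one k
  have hq0 : (0 : ℝ) < (1 / 2) ^ k := by positivity
  calc cubeProb (fun ω => Occurs t ω ∧ Occurs s ω)
      ≤ cubeProb (fun ω => (Induces t ω ∧ Induces s ω) ∧
          ∀ v ∈ (support t ∪ support s)ᶜ, Touches t.1 v ω ∧ Touches t.2.1 v ω) := by
        refine cubeProb_mono fun ω h => ?_
        rw [occurs_iff hk ht, occurs_iff hk hs] at h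
        refine ⟨⟨h.1.1, h.2.1⟩, fun v hv => h.1.2 v ?_⟩
        rw [Finset.mem_compl] at hv ⊢
        exact fun hv' => hv (Finset.mem_union_left _ hv')
    _ = cubeProb (fun ω => Induces t ω ∧ Induces s ω) *
          ((1 - (1 / 2) ^ k) ^ 2) ^ (support t ∪ support s)ᶜ.card := by
        rw [cubeProb_inside_and_outside induces_two_dependsOn fun v => touches_two_dependsOn v
          (left_subset_support.trans Finset.subset_union_left)
          (right_subset_support.trans Finset.subset_union_left)]
        simp_rw [cubeProb_touches_two hd, h1, h2, Finset.prod_const, sq]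
    _ ≤ _ := by
        refine mul_le_mul (cubeProb_induces_two_le ht hs) ?_ (by positivity) (by positivity)
        refine pow_le_pow_of_le_one (by positivity) ?_ (card_compl_union_ge ht hs)
        exact pow_le_one₀ (by linarith) (by linarith)

theorem cubeProb_occurs_two_le_fine (hk : 0 < k) (ht : t ∈ triples n k) (hs : s ∈ triples n k)
    {j : ℕ} (hj : (support t ∩ support s).card ≤ j) (hjk : 6 * ((1 / 2 : ℝ) ^ k * 2 ^ j) ≤ 4) :
    cubeProb (fun ω => Occurs t ω ∧ Occurs s ω) ≤
      (1 / 2) ^ (2 * (2 * k + 1).choose 2 - (support t ∩ support s).card.choose 2) *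
        (1 - 4 * (1 / 2) ^ k + 6 * (((1 / 2) ^ k) ^ 2 * 2 ^ j)) ^ (n - 2 * (2 * k + 1)) := by
  obtain ⟨h1, h2, hd, -, -⟩ := mem_triples.mp ht
  obtain ⟨h1', h2', hd', -, -⟩ := mem_triples.mp hs
  have hq0 : (0 : ℝ) < (1 / 2) ^ k := by positivity
  have hinter : ∀ {E F : Finset (Fin n)}, E ⊆ support t → F ⊆ support s → (E ∩ F).card ≤ j :=
    fun hE hF => (Finset.card_le_card (Finset.inter_subset_inter hE hF)).trans hj
  have hfour : ∀ v, cubeProb (fun ω => (Touches t.1 v ω ∧ Touches t.2.1 v ω) ∧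
      Touches s.1 v ω ∧ Touches s.2.1 v ω) ≤
      1 - 4 * (1 / 2) ^ k + 6 * (((1 / 2) ^ k) ^ 2 * 2 ^ j) := fun v =>
    cubeProb_touches_four_le v h1 h2 h1' h2'
      (by rw [Finset.disjoint_iff_inter_eq_empty.mp hd]; simp)
      (hinter left_subset_support left_subset_support)
      (hinter left_subset_support right_subset_support)
      (hinter right_subset_support left_subset_support)
      (hinter right_subset_support right_subset_support)
      (by rw [Finset.disjoint_iff_inter_eq_empty.mp hd']; simp)
  have hb0 : 0 ≤ 1 - 4 * (1 / 2 : ℝ) ^ k + 6 * (((1 / 2) ^ k) ^ 2 * 2 ^ j) :=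
    (cubeProb_nonneg _).trans (hfour t.2.2)
  calc cubeProb (fun ω => Occurs t ω ∧ Occurs s ω)
      ≤ cubeProb (fun ω => (Induces t ω ∧ Induces s ω) ∧
          ∀ v ∈ (support t ∪ support s)ᶜ, (Touches t.1 v ω ∧ Touches t.2.1 v ω) ∧
            Touches s.1 v ω ∧ Touches s.2.1 v ω) := by
        refine cubeProb_mono fun ω h => ?_
        rw [occurs_iff hk ht, occurs_iff hk hs] at h
        refine ⟨⟨h.1.1, h.2.1⟩, fun v hv => ?_⟩
        rw [Finset.mem_compl, Finset.mem_union, not_or] at hv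
        exact ⟨h.1.2 v (Finset.mem_compl.mpr hv.1), h.2.2 v (Finset.mem_compl.mpr hv.2)⟩
    _ = cubeProb (fun ω => Induces t ω ∧ Induces s ω) *
          ∏ v ∈ (support t ∪ support s)ᶜ, cubeProb (fun ω => (Touches t.1 v ω ∧ Touches t.2.1 v ω) ∧
            Touches s.1 v ω ∧ Touches s.2.1 v ω) :=
        cubeProb_inside_and_outside induces_two_dependsOn fun v =>
          ((touches_two_dependsOn v (left_subset_support.trans Finset.subset_union_left)
            (right_subset_support.trans Finset.subset_union_left)).and_prop
          (touches_two_dependsOn v (left_subset_support.trans Finset.subset_union_right)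
            (right_subset_support.trans Finset.subset_union_right))).mono_set
            (Set.union_subset subset_rfl subset_rfl)
    _ ≤ cubeProb (fun ω => Induces t ω ∧ Induces s ω) *
          (1 - 4 * (1 / 2) ^ k + 6 * (((1 / 2) ^ k) ^ 2 * 2 ^ j)) ^
            (support t ∪ support s)ᶜ.card := by
        refine mul_le_mul_of_nonneg_left ?_ (cubeProb_nonneg _)
        rw [← Finset.prod_const]
        exact Finset.prod_le_prod (fun v _ => cubeProb_nonneg _) fun v _ => hfour v
    _ ≤ _ := by
        refine mul_le_mul (cubeProb_induces_two_le ht hs) ?_ (by positivity) (by positivity)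
        refine pow_le_pow_of_le_one hb0 ?_ (card_compl_union_ge ht hs)
        nlinarith

end PairProbabilities

section DisjointPairs

open scoped Classical

variable {n k : ℕ} {t s : Finset (Fin n) × Finset (Fin n) × Fin n}

/-- The pairs joining two sets. -/
def crossPairs (A B : Finset (Fin n)) : Finset (Sym2 (Fin n)) :=
  A.biUnion fun v => starTo v B

theorem starTo_subset_crossPairs {A B : Finset (Fin n)} {v : Fin n} (hv : v ∈ A) :
    (starTo v B : Set (Sym2 (Fin n))) ⊆ crossPairs A B :=
  Finset.coe_subset.mpr (Finset.subset_biUnion_of_mem (fun v => starTo v B) hv)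

theorem mem_crossPairs {A B : Finset (Fin n)} {a b : Fin n} :
    s(a, b) ∈ crossPairs A B ↔ (a ∈ A ∧ b ∈ B) ∨ (b ∈ A ∧ a ∈ B) := by
  simp only [crossPairs, Finset.mem_biUnion, mem_starTo]
  constructor
  · rintro ⟨v, hv, ⟨rfl, h⟩ | ⟨rfl, h⟩⟩
    exacts [Or.inl ⟨hv, h⟩, Or.inr ⟨hv, h⟩]
  · rintro (⟨h, h'⟩ | ⟨h, h'⟩)
    exacts [⟨a, h, Or.inl ⟨rfl, h'⟩⟩, ⟨b, h, Or.inr ⟨rfl, h'⟩⟩]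

/-- All vertices of `A` have neighbors in both cliques of `s`. -/
def Dominates (s : Finset (Fin n) × Finset (Fin n) × Fin n) (A : Finset (Fin n))
    (ω : Sym2 (Fin n) → Bool) : Prop :=
  ∀ v ∈ A, Touches s.1 v ω ∧ Touches s.2.1 v ω

theorem dominates_dependsOn (s : Finset (Fin n) × Finset (Fin n) × Fin n) (A : Finset (Fin n)) :
    DependsOn (Dominates s A) (crossPairs A (support s)) :=
  (DependsOn.forall_mem fun v (_ : v ∈ A) =>
    touches_two_dependsOn v left_subset_support right_subset_support).mono_set
    (Set.iUnion₂_subset fun _ hv => starTo_subset_crossPairs hv)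

theorem cubeProb_not_dominates_le (hs : s ∈ triples n k) (A : Finset (Fin n)) :
    cubeProb (fun ω => ¬ Dominates s A ω) ≤ A.card * (2 * (1 / 2) ^ k) := by
  obtain ⟨h1, h2, -, -, -⟩ := mem_triples.mp hs
  calc cubeProb (fun ω => ¬ Dominates s A ω)
      ≤ cubeProb (fun ω => ∃ v ∈ A, ¬ Touches s.1 v ω ∨ ¬ Touches s.2.1 v ω) := by
        refine cubeProb_mono fun ω h => ?_
        simp only [Dominates, not_forall] at h
        obtain ⟨v, hv, h⟩ := h
        exact ⟨v, hv, not_and_or.mp h⟩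
    _ ≤ ∑ v ∈ A, cubeProb (fun ω => ¬ Touches s.1 v ω ∨ ¬ Touches s.2.1 v ω) :=
        cubeProb_exists_le A _
    _ ≤ ∑ v ∈ A, 2 * (1 / 2 : ℝ) ^ k := by
        refine Finset.sum_le_sum fun v _ => (cubeProb_or_le _ _).trans ?_
        rw [cubeProb_not_touches, cubeProb_not_touches, h1, h2, two_mul]
    _ = _ := by simp

theorem cubeProb_induces_two_eq (ht : t ∈ triples n k) (hs : s ∈ triples n k)
    (hd : Disjoint (support t) (support s)) :
    cubeProb (fun ω => Induces t ω ∧ Induces s ω) = ((1 / 2) ^ (2 * k + 1).choose 2) ^ 2 := by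
  rw [cubeProb_and (induces_dependsOn t) (induces_dependsOn s), cubeProb_induces ht,
    cubeProb_induces hs, sq]
  rw [Finset.disjoint_coe, Finset.disjoint_iff_inter_eq_empty, pairsIn_inter,
    Finset.disjoint_iff_inter_eq_empty.mp hd]
  rfl

theorem cubeProb_occurs_two_ge (hk : 0 < k) (ht : t ∈ triples n k) (hs : s ∈ triples n k)
    (hd : Disjoint (support t) (support s)) :
    ((1 / 2 : ℝ) ^ (2 * k + 1).choose 2) ^ 2 * (1 - 4 * (2 * k + 1) * (1 / 2) ^ k) *
        (((1 - (1 / 2) ^ k) ^ 2) ^ (n - 2 * (2 * k + 1))) ^ 2 ≤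
      cubeProb (fun ω => Occurs t ω ∧ Occurs s ω) := by
  obtain ⟨h1, h2, hd1, -, -⟩ := mem_triples.mp ht
  obtain ⟨h1', h2', hd1', -, -⟩ := mem_triples.mp hs
  have hU : (support t ∪ support s)ᶜ.card = n - 2 * (2 * k + 1) := by
    rw [Finset.card_compl, Finset.card_union_of_disjoint hd, card_support ht, card_support hs,
      Fintype.card_fin]
    omega
  set U := support t ∪ support s with hUdef
  have hcross : (crossPairs (support s) (support t) : Set (Sym2 (Fin n))) ∪
      crossPairs (support t) (support s) ⊆ crossPairs (support t) (support s) := by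
    rw [← Finset.coe_union, Finset.coe_subset]
    intro e he
    induction e with
    | _ a b =>
      rw [Finset.mem_union, mem_crossPairs, mem_crossPairs] at he
      rw [mem_crossPairs]
      tauto
  have hcrossDep : DependsOn (fun ω => Dominates t (support s) ω ∧ Dominates s (support t) ω)
      (crossPairs (support t) (support s) : Set (Sym2 (Fin n))) :=
    ((dominates_dependsOn t _).and_prop (dominates_dependsOn s _)).mono_set hcross
  have hcrossProb : 1 - 4 * (2 * k + 1) * (1 / 2) ^ k ≤
      cubeProb (fun ω => Dominates t (support s) ω ∧ Dominates s (support t) ω) := by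
    have hnot := cubeProb_not (ι := Sym2 (Fin n))
      (fun ω => Dominates t (support s) ω ∧ Dominates s (support t) ω)
    have hle : cubeProb (fun ω => ¬ (Dominates t (support s) ω ∧ Dominates s (support t) ω)) ≤
        (support s).card * (2 * (1 / 2) ^ k) + (support t).card * (2 * (1 / 2) ^ k) := by
      rw [cubeProb_congr fun ω => not_and_or]
      exact (cubeProb_or_le _ _).trans
        (add_le_add (cubeProb_not_dominates_le ht _) (cubeProb_not_dominates_le hs _))
    rw [card_support ht, card_support hs] at hle
    push_cast at hle
    linarith
  have hcrossPairs : (crossPairs (support t) (support s) : Set (Sym2 (Fin n))) ⊆ pairsIn U := by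
    rw [Finset.coe_subset]
    intro e he
    induction e with
    | _ a b =>
      rw [mem_crossPairs] at he
      rw [mk_mem_pairsIn, hUdef, Finset.mem_union, Finset.mem_union]
      rcases he with ⟨ha, hb⟩ | ⟨hb, ha⟩
      · exact ⟨Or.inl ha, Or.inr hb, by rintro rfl; exact Finset.disjoint_left.mp hd ha hb⟩
      · exact ⟨Or.inr ha, Or.inl hb, by rintro rfl; exact Finset.disjoint_left.mp hd hb ha⟩
  have hdisj : Disjoint ((pairsIn (support t) : Set (Sym2 (Fin n))) ∪ pairsIn (support s))
      (crossPairs (support t) (support s)) := by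
    rw [← Finset.coe_union, Finset.disjoint_coe, Finset.disjoint_left]
    intro e
    induction e with
    | _ a b =>
      rw [Finset.mem_union, mk_mem_pairsIn, mk_mem_pairsIn, mem_crossPairs]
      have hmem : ∀ c, c ∈ support t → c ∉ support s := fun _ h => Finset.disjoint_left.mp hd h
      have ha := hmem a
      have hb := hmem b
      tauto
  have hout : ∀ v, cubeProb (fun ω => (Touches t.1 v ω ∧ Touches t.2.1 v ω) ∧
      Touches s.1 v ω ∧ Touches s.2.1 v ω) = ((1 - (1 / 2) ^ k) ^ 2) ^ 2 := by
    intro v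
    rw [cubeProb_and (touches_two_dependsOn v left_subset_support right_subset_support)
      (touches_two_dependsOn v left_subset_support right_subset_support)
      (starTo_disjoint_of_disjoint v hd), cubeProb_touches_two hd1, cubeProb_touches_two hd1',
      h1, h2, h1', h2', ← sq, ← sq]
  calc ((1 / 2 : ℝ) ^ (2 * k + 1).choose 2) ^ 2 * (1 - 4 * (2 * k + 1) * (1 / 2) ^ k) *
        (((1 - (1 / 2) ^ k) ^ 2) ^ (n - 2 * (2 * k + 1))) ^ 2
      ≤ ((1 / 2 : ℝ) ^ (2 * k + 1).choose 2) ^ 2 *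
          cubeProb (fun ω => Dominates t (support s) ω ∧ Dominates s (support t) ω) *
        (((1 - (1 / 2) ^ k) ^ 2) ^ (n - 2 * (2 * k + 1))) ^ 2 := by gcongr
    _ = cubeProb (fun ω => ((Induces t ω ∧ Induces s ω) ∧
          Dominates t (support s) ω ∧ Dominates s (support t) ω) ∧
          ∀ v ∈ Uᶜ, (Touches t.1 v ω ∧ Touches t.2.1 v ω) ∧
            Touches s.1 v ω ∧ Touches s.2.1 v ω) := by
        rw [cubeProb_inside_and_outside (U := U)
          (((induces_two_dependsOn (t := t) (s := s)).and_prop hcrossDep).mono_set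
            (Set.union_subset subset_rfl hcrossPairs)) fun v =>
          ((touches_two_dependsOn v (left_subset_support.trans Finset.subset_union_left)
            (right_subset_support.trans Finset.subset_union_left)).and_prop
          (touches_two_dependsOn v (left_subset_support.trans Finset.subset_union_right)
            (right_subset_support.trans Finset.subset_union_right))).mono_set
            (Set.union_subset subset_rfl subset_rfl),
          cubeProb_and ((induces_dependsOn t).and_prop (induces_dependsOn s)) hcrossDep hdisj,
          cubeProb_induces_two_eq ht hs hd]
        simp_rw [hout, Finset.prod_const, hU]
        rw [pow_right_comm _ (n - 2 * (2 * k + 1)) 2]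
    _ ≤ _ := by
        refine cubeProb_mono fun ω h => ?_
        obtain ⟨⟨⟨hIt, hIs⟩, hDs, hDt⟩, hO⟩ := h
        rw [occurs_iff hk ht, occurs_iff hk hs]
        refine ⟨⟨hIt, fun v hv => ?_⟩, hIs, fun v hv => ?_⟩
        · by_cases hvs : v ∈ support s
          · exact hDs v hvs
          · exact (hO v (by simp [hUdef, hvs, Finset.mem_compl.mp hv])).1
        · by_cases hvt : v ∈ support t
          · exact hDt v hvt
          · exact (hO v (by simp [hUdef, hvt, Finset.mem_compl.mp hv])).2

end DisjointPairs

section Counting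

open scoped Classical

variable {n k : ℕ} {t s : Finset (Fin n) × Finset (Fin n) × Fin n}

theorem eq_sdiff_of_mem_triples (hs : s ∈ triples n k) :
    s.2.1 = (support s).erase s.2.2 \ s.1 := by
  obtain ⟨-, -, hd, hx1, hx2⟩ := mem_triples.mp hs
  ext v
  have h1 : v ∈ s.1 → v ∉ s.2.1 := fun h => Finset.disjoint_left.mp hd h
  have h2 : v ∈ s.2.1 → v ≠ s.2.2 := by rintro h rfl; exact hx2 h
  rw [Finset.mem_sdiff, Finset.mem_erase, mem_support]
  tauto

/-- Every set of `2 * k + 1` vertices supports the same number of candidates. -/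
theorem card_filter_support_eq {W : Finset (Fin n)} (hW : W.card = 2 * k + 1) :
    ((triples n k).filter fun s => support s = W).card = (2 * k + 1) * (2 * k).choose k := by
  have hcard : (W.sigma fun y => Finset.powersetCard k (W.erase y)).card =
      (2 * k + 1) * (2 * k).choose k := by
    rw [Finset.card_sigma, Finset.sum_const_nat (m := (2 * k).choose k), hW]
    intro y hy
    rw [Finset.card_powersetCard, Finset.card_erase_of_mem hy, hW, Nat.add_sub_cancel]
  rw [← hcard]
  refine Finset.card_nbij' (fun s => ⟨s.2.2, s.1⟩) (fun z => (z.2, W.erase z.1 \ z.2, z.1))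
    ?_ ?_ ?_ ?_
  · intro s hs
    rw [Finset.mem_coe, Finset.mem_filter] at hs
    obtain ⟨hs, rfl⟩ := hs
    obtain ⟨h1, -, -, hx1, -⟩ := mem_triples.mp hs
    refine Finset.mem_coe.mpr (Finset.mem_sigma.mpr ⟨mem_support.mpr (Or.inl rfl), ?_⟩)
    exact Finset.mem_powersetCard.mpr
      ⟨fun v hv => Finset.mem_erase.mpr ⟨by rintro rfl; exact hx1 hv, left_subset_support hv⟩, h1⟩
  · rintro ⟨y, A⟩ hz
    obtain ⟨hy, hA⟩ := Finset.mem_sigma.mp hz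
    obtain ⟨hAW, hAk⟩ := Finset.mem_powersetCard.mp hA
    refine Finset.mem_coe.mpr (Finset.mem_filter.mpr ⟨mem_triples.mpr
      ⟨hAk, ?_, Finset.disjoint_sdiff, fun h => by simpa using hAW h, by simp⟩, ?_⟩)
    · change (W.erase y \ A).card = k
      rw [Finset.card_sdiff_of_subset hAW, Finset.card_erase_of_mem hy, hW, hAk]
      omega
    · rw [support, Finset.union_sdiff_of_subset hAW, Finset.insert_erase hy]
  · intro s hs
    rw [Finset.mem_coe, Finset.mem_filter] at hs
    obtain ⟨hs, rfl⟩ := hs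
    simp only [← eq_sdiff_of_mem_triples hs]
  · intro z _
    rfl

theorem card_filter_support (P : Finset (Fin n) → Prop) [DecidablePred P] :
    ((triples n k).filter fun s => P (support s)).card =
      ((Finset.powersetCard (2 * k + 1) Finset.univ).filter P).card *
        ((2 * k + 1) * (2 * k).choose k) := by
  rw [Finset.card_eq_sum_card_fiberwise (f := support)
    (t := (Finset.powersetCard (2 * k + 1) Finset.univ).filter P), Finset.sum_const_nat]
  · intro W hW
    obtain ⟨hW, hP⟩ := Finset.mem_filter.mp hW
    rw [← card_filter_support_eq (Finset.mem_powersetCard.mp hW).2, Finset.filter_filter]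
    congr 1
    refine Finset.filter_congr fun s _ => ⟨fun h => h.2, fun h => ⟨h ▸ hP, h⟩⟩
  · intro s hs
    obtain ⟨hs, hP⟩ := Finset.mem_filter.mp hs
    exact Finset.mem_coe.mpr (Finset.mem_filter.mpr
      ⟨Finset.mem_powersetCard.mpr ⟨Finset.subset_univ _, card_support hs⟩, hP⟩)

theorem card_triples (n k : ℕ) :
    (triples n k).card = n.choose (2 * k + 1) * ((2 * k + 1) * (2 * k).choose k) := by
  have h := card_filter_support (n := n) (k := k) fun _ => True
  simpa using h

theorem card_filter_inter_le {m j : ℕ} {Z : Finset (Fin n)} (hZ : Z.card = m) (hj : j ≤ m) :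
    ((Finset.powersetCard m Finset.univ).filter fun W => (Z ∩ W).card = j).card ≤
      m.choose j * (n - j).choose (m - j) := by
  calc ((Finset.powersetCard m Finset.univ).filter fun W => (Z ∩ W).card = j).card
      ≤ (Finset.powersetCard j Z ×ˢ Finset.powersetCard (m - j) Zᶜ).card := by
        refine Finset.card_le_card_of_injOn (fun W => (Z ∩ W, W \ Z)) ?_ ?_
        · intro W hW
          obtain ⟨hW, hj⟩ := Finset.mem_filter.mp hW
          have hWm := (Finset.mem_powersetCard.mp hW).2
          refine Finset.mem_coe.mpr (Finset.mem_product.mpr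
            ⟨Finset.mem_powersetCard.mpr ⟨Finset.inter_subset_left, hj⟩,
              Finset.mem_powersetCard.mpr ⟨fun v hv => ?_, ?_⟩⟩)
          · exact Finset.mem_compl.mpr (Finset.mem_sdiff.mp hv).2
          · change (W \ Z).card = m - j
            rw [Finset.card_sdiff, hWm, hj]
        · intro W _ W' _ h
          obtain ⟨h1, h2⟩ := Prod.mk.inj h
          rw [← Finset.sdiff_union_inter W Z, ← Finset.sdiff_union_inter W' Z, h2,
            Finset.inter_comm W, Finset.inter_comm W', h1]
    _ ≤ _ := by
        rw [Finset.card_product, Finset.card_powersetCard, Finset.card_powersetCard, hZ,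
          Finset.card_compl, hZ, Fintype.card_fin]
        exact Nat.mul_le_mul_left _ (Nat.choose_le_choose _ (by omega))

theorem card_filter_not_disjoint_le {m : ℕ} {Z : Finset (Fin n)} (hZ : Z.card = m) :
    ((Finset.powersetCard m Finset.univ).filter fun W => ¬ Disjoint Z W).card ≤
      m * (n - 1).choose (m - 1) := by
  calc ((Finset.powersetCard m Finset.univ).filter fun W => ¬ Disjoint Z W).card
      ≤ (Z.biUnion fun z => (Finset.powersetCard m Finset.univ).filter fun W => z ∈ W).card := by
        refine Finset.card_le_card fun W hW => ?_
        obtain ⟨hW, hd⟩ := Finset.mem_filter.mp hW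
        obtain ⟨z, hz, hzW⟩ := Finset.not_disjoint_iff.mp hd
        exact Finset.mem_biUnion.mpr ⟨z, hz, Finset.mem_filter.mpr ⟨hW, hzW⟩⟩
    _ ≤ ∑ z ∈ Z, ((Finset.powersetCard m Finset.univ).filter fun W => z ∈ W).card :=
        Finset.card_biUnion_le
    _ ≤ ∑ z ∈ Z, (n - 1).choose (m - 1) := by
        refine Finset.sum_le_sum fun z _ => ?_
        calc ((Finset.powersetCard m Finset.univ).filter fun W => z ∈ W).card
            ≤ (Finset.powersetCard (m - 1) (Finset.univ.erase z)).card := by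
              refine Finset.card_le_card_of_injOn (fun W => W.erase z) ?_ ?_
              · intro W hW
                obtain ⟨hW, hz⟩ := Finset.mem_filter.mp hW
                have hWm := (Finset.mem_powersetCard.mp hW).2
                exact Finset.mem_coe.mpr (Finset.mem_powersetCard.mpr
                  ⟨Finset.erase_subset_erase _ (Finset.subset_univ _),
                    by rw [Finset.card_erase_of_mem hz, hWm]⟩)
              · intro W hW W' hW' h
                rw [← Finset.insert_erase (Finset.mem_filter.mp hW).2,
                  ← Finset.insert_erase (Finset.mem_filter.mp hW').2]
                exact congrArg (insert z) h
          _ = (n - 1).choose (m - 1) := by simp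
    _ = _ := by simp [hZ]

/-- The patterns of two candidates can be realized simultaneously. -/
def Compatible (t s : Finset (Fin n) × Finset (Fin n) × Fin n) : Prop :=
  ∃ ω, Induces t ω ∧ Induces s ω

theorem Compatible.pattern_eq (h : Compatible t s) {u v : Fin n} (hut : u ∈ support t)
    (hvt : v ∈ support t) (hus : u ∈ support s) (hvs : v ∈ support s) (huv : u ≠ v) :
    pattern t s(u, v) = true ↔ pattern s s(u, v) = true := by
  obtain ⟨ω, h1, h2⟩ := h
  rw [← h1 _ (mk_mem_pairsIn.mpr ⟨hut, hvt, huv⟩), h2 _ (mk_mem_pairsIn.mpr ⟨hus, hvs, huv⟩)]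

theorem Compatible.mem_left_iff (h : Compatible t s) (hs : s ∈ triples n k) {u v : Fin n}
    (hut : u ∈ support t) (hvt : v ∈ support t) (hus : u ∈ support s) (hvs : v ∈ support s)
    (huv : u ≠ v) (hu : u ≠ s.2.2) (hv : v ≠ s.2.2) :
    v ∈ s.1 ↔ (u ∈ s.1 ↔ pattern t s(u, v) = true) := by
  obtain ⟨-, -, hd, -, -⟩ := mem_triples.mp hs
  have hd' : ∀ c, c ∈ s.1 → c ∉ s.2.1 := fun _ h => Finset.disjoint_left.mp hd h
  have h1 := hd' u
  have h2 := hd' v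
  rw [h.pattern_eq hut hvt hus hvs huv, pattern_mk_eq_true]
  rw [mem_support] at hus hvs
  tauto

theorem card_compatible_le (W : Finset (Fin n)) (hW : W.card = 2 * k + 1) :
    ((triples n k).filter fun s => support s = W ∧ Compatible t s).card ≤
      (2 * k + 1) * (2 * 2 ^ (W \ support t).card) := by
  have hp : ∀ y, ∃ p, ∀ v ∈ (support t ∩ W).erase y, p ∈ (support t ∩ W).erase y := by
    intro y
    by_cases h : ((support t ∩ W).erase y).Nonempty
    · exact ⟨h.choose, fun _ _ => h.choose_spec⟩
    · exact ⟨y, fun v hv => absurd ⟨v, hv⟩ h⟩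
  choose p hp using hp
  calc ((triples n k).filter fun s => support s = W ∧ Compatible t s).card
      ≤ (W ×ˢ ((Finset.univ : Finset Bool) ×ˢ (W \ support t).powerset)).card := by
        refine Finset.card_le_card_of_injOn
          (fun s => (s.2.2, decide (p s.2.2 ∈ s.1), s.1 \ support t)) ?_ ?_
        · intro s hs
          rw [Finset.mem_coe, Finset.mem_filter] at hs
          obtain ⟨hs, rfl, hc⟩ := hs
          exact Finset.mem_coe.mpr (Finset.mem_product.mpr ⟨mem_support.mpr (Or.inl rfl),
            Finset.mem_product.mpr ⟨Finset.mem_univ _, Finset.mem_powerset.mpr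
              (Finset.sdiff_subset_sdiff left_subset_support subset_rfl)⟩⟩)
        · intro s hs s' hs' h
          rw [Finset.mem_coe, Finset.mem_filter] at hs hs'
          obtain ⟨hs, rfl, hc⟩ := hs
          obtain ⟨hs', hW', hc'⟩ := hs'
          obtain ⟨hy, h⟩ := Prod.mk.inj h
          obtain ⟨hbit, hout⟩ := Prod.mk.inj h
          rw [decide_eq_decide] at hbit
          have hx := (mem_triples.mp hs).2.2.2.1
          have hx' := (mem_triples.mp hs').2.2.2.1
          have h1 : s.1 = s'.1 := by
            ext v
            by_cases hvt : v ∈ support t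
            · by_cases hvs : v ∈ support s
              · by_cases hvy : v = s.2.2
                · rw [hvy]
                  exact iff_of_false hx (hy ▸ hx')
                · have hvp := hp s.2.2 v
                    (Finset.mem_erase.mpr ⟨hvy, Finset.mem_inter.mpr ⟨hvt, hvs⟩⟩)
                  obtain ⟨hpy, hpts⟩ := Finset.mem_erase.mp hvp
                  obtain ⟨hpt, hps⟩ := Finset.mem_inter.mp hpts
                  rw [← hy] at hbit
                  by_cases hpv : p s.2.2 = v
                  · rwa [hpv] at hbit
                  · rw [hc.mem_left_iff hs hpt hvt hps hvs hpv hpy hvy,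
                      hc'.mem_left_iff hs' hpt hvt (hW' ▸ hps) (hW' ▸ hvs) hpv (hy ▸ hpy)
                        (hy ▸ hvy), hbit]
              · exact iff_of_false (fun h => hvs (left_subset_support h))
                  fun h => hvs (hW' ▸ left_subset_support h)
            · have := Finset.ext_iff.mp hout v
              simpa [hvt] using this
          refine Prod.ext h1 (Prod.ext ?_ hy)
          rw [eq_sdiff_of_mem_triples hs, eq_sdiff_of_mem_triples hs', hW', hy, h1]
    _ = _ := by simp [hW]

theorem Compatible.eq_or_eq_swap (h : Compatible t s) (hk : 0 < k) (ht : t ∈ triples n k)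
    (hs : s ∈ triples n k) (hts : support t = support s) : s = t ∨ s = swapTriple t := by
  obtain ⟨h1, h2, hd, hx1, hx2⟩ := mem_triples.mp ht
  obtain ⟨h1', h2', hd', hx1', hx2'⟩ := mem_triples.mp hs
  have hpat : ∀ {u v}, u ∈ support t → v ∈ support t → u ≠ v →
      (pattern t s(u, v) = true ↔ pattern s s(u, v) = true) :=
    fun hu hv huv => h.pattern_eq hu hv (hts ▸ hu) (hts ▸ hv) huv
  have hcross : ∀ {u v}, u ∈ t.1 → v ∈ t.2.1 → u ≠ s.2.2 ∧ v ≠ s.2.2 ∧ (u ∈ s.1 → v ∉ s.1) := by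
    intro u v hu hv
    have huv : u ≠ v := by rintro rfl; exact Finset.disjoint_left.mp hd hu hv
    have hf := (hpat (left_subset_support hu) (right_subset_support hv) huv).not.mp
      (by simp [pattern_cross hu hv])
    rw [pattern_mk_eq_true] at hf
    have hd'' : ∀ c, c ∈ s.1 → c ∉ s.2.1 := fun _ h => Finset.disjoint_left.mp hd' h
    have := hd'' u
    have := hd'' v
    refine ⟨?_, ?_, ?_⟩
    · rintro rfl
      tauto
    · rintro rfl
      tauto
    · tauto
  have hn1 : t.1.Nonempty := Finset.card_pos.mp (by omega)
  have hn2 : t.2.1.Nonempty := Finset.card_pos.mp (by omega)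
  have hy : s.2.2 = t.2.2 := by
    have hmem : s.2.2 ∈ support t := hts ▸ mem_support.mpr (Or.inl rfl)
    obtain ⟨a, ha⟩ := hn1
    obtain ⟨b, hb⟩ := hn2
    rcases mem_support.mp hmem with hy | hy | hy
    · exact hy
    · exact absurd rfl (hcross hy hb).1
    · exact absurd rfl (hcross ha hy).2.1
  have hmem : ∀ {v}, v ∈ s.1 → v ∈ t.1 ∨ v ∈ t.2.1 := by
    intro v hv
    rcases mem_support.mp (hts ▸ left_subset_support hv : v ∈ support t) with h | h
    · rw [← hy] at h
      exact absurd (h ▸ hv) hx1'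
    · exact h
  by_cases hsub : s.1 ⊆ t.1
  · left
    have h11 : s.1 = t.1 := Finset.eq_of_subset_of_card_le hsub (by omega)
    refine Prod.ext h11 (Prod.ext ?_ hy)
    rw [eq_sdiff_of_mem_triples hs, eq_sdiff_of_mem_triples ht, hts, hy, h11]
  · right
    obtain ⟨a, ha, hat⟩ := Finset.not_subset.mp hsub
    have ha2 := (hmem ha).resolve_left hat
    have hsub2 : s.1 ⊆ t.2.1 := fun b hb =>
      (hmem hb).resolve_left fun hb1 => (hcross hb1 ha2).2.2 hb ha
    have h12 : s.1 = t.2.1 := Finset.eq_of_subset_of_card_le hsub2 (by omega)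
    have hsw : support (swapTriple t) = support t := by
      simp [support, swapTriple, Finset.union_comm]
    refine Prod.ext h12 (Prod.ext ?_ hy)
    have hsd := eq_sdiff_of_mem_triples (swapTriple_mem ht)
    rw [eq_sdiff_of_mem_triples hs, hsd, hsw, hts, hy, h12]
    rfl

end Counting

section PairSums

open scoped Classical

variable {n k : ℕ} {t s : Finset (Fin n) × Finset (Fin n) × Fin n}

theorem card_filter_inter_triples_le (ht : t ∈ triples n k) {j : ℕ} (hj : j ≤ 2 * k + 1) :
    ((triples n k).filter fun s => (support t ∩ support s).card = j).card ≤
      (2 * k + 1).choose j * (n - j).choose (2 * k + 1 - j) * ((2 * k + 1) * (2 * k).choose k) := by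
  rw [card_filter_support fun W => (support t ∩ W).card = j]
  exact Nat.mul_le_mul_right _ (card_filter_inter_le (card_support ht) hj)

theorem card_filter_inter_compatible_le (ht : t ∈ triples n k) {j : ℕ} (hj : j ≤ 2 * k + 1) :
    ((triples n k).filter fun s =>
        (support t ∩ support s).card = j ∧ Compatible t s).card ≤
      (2 * k + 1).choose j * (n - j).choose (2 * k + 1 - j) *
        ((2 * k + 1) * (2 * 2 ^ (2 * k + 1 - j))) := by
  refine le_trans ?_ (Nat.mul_le_mul_right _ (card_filter_inter_le (card_support ht) hj))
  rw [mul_comm]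
  refine Finset.card_le_mul_card_image_of_maps_to (f := support) (fun s hs => ?_) _ fun W hW => ?_
  · rw [Finset.mem_filter] at hs
    exact Finset.mem_filter.mpr
      ⟨Finset.mem_powersetCard.mpr ⟨Finset.subset_univ _, card_support hs.1⟩, hs.2.1⟩
  · rw [Finset.mem_filter, Finset.mem_powersetCard] at hW
    obtain ⟨⟨-, hW⟩, hj⟩ := hW
    have hsd : (W \ support t).card = 2 * k + 1 - j := by
      rw [Finset.card_sdiff, hW, hj]
    rw [← hsd]
    refine le_trans (Finset.card_le_card fun s hs => ?_) (card_compatible_le W hW)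
    simp only [Finset.mem_filter] at hs ⊢
    exact ⟨hs.1.1, hs.2, hs.1.2.2⟩

theorem cubeProb_occurs_two_eq_zero (hk : 0 < k) (ht : t ∈ triples n k) (hs : s ∈ triples n k)
    (h : ¬ Compatible t s) : cubeProb (fun ω => Occurs t ω ∧ Occurs s ω) = 0 :=
  cubeProb_eq_zero fun ω hω =>
    h ⟨ω, ((occurs_iff hk ht ω).mp hω.1).1, ((occurs_iff hk hs ω).mp hω.2).1⟩

/-- Upper bound for the probability that two candidates both occur, split according to the
overlap of their supports. -/
theorem cubeProb_occurs_two_le (hk : 0 < k) (ht : t ∈ triples n k) (hs : s ∈ triples n k) {J : ℕ}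
    (hJ : 6 * ((1 / 2 : ℝ) ^ k * 2 ^ J) ≤ 4) :
    cubeProb (fun ω => Occurs t ω ∧ Occurs s ω) ≤
      ((if s = t then cubeProb (Occurs t) else 0) +
        if s = swapTriple t then cubeProb (Occurs t) else 0) +
      ∑ j ∈ Finset.range (J + 1), (if (support t ∩ support s).card = j then
        (1 / 2) ^ (2 * (2 * k + 1).choose 2 - j.choose 2) *
          (1 - 4 * (1 / 2) ^ k + 6 * (((1 / 2) ^ k) ^ 2 * 2 ^ J)) ^ (n - 2 * (2 * k + 1)) else 0) +
      ∑ j ∈ Finset.Ico (J + 1) (2 * k + 1),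
        (if (support t ∩ support s).card = j ∧ Compatible t s then
        (1 / 2) ^ (2 * (2 * k + 1).choose 2 - j.choose 2) *
          ((1 - (1 / 2) ^ k) ^ 2) ^ (n - 2 * (2 * k + 1)) else 0) := by
  set q : ℝ := (1 / 2) ^ k with hq
  have hq0 : 0 < q := by positivity
  have hbase : 0 ≤ 1 - 4 * q + 6 * (q ^ 2 * 2 ^ J) := by
    have h1 : (1 : ℝ) ≤ 2 ^ J := one_le_pow₀ (by norm_num)
    nlinarith [mul_le_mul_of_nonneg_left h1 (sq_nonneg q), sq_nonneg (1 - 2 * q)]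
  have hA : 0 ≤ (if s = t then cubeProb (Occurs t) else 0) := by
    split_ifs
    exacts [cubeProb_nonneg _, le_rfl]
  have hB : 0 ≤ (if s = swapTriple t then cubeProb (Occurs t) else 0) := by
    split_ifs
    exacts [cubeProb_nonneg _, le_rfl]
  have hC : ∀ j ∈ Finset.range (J + 1), 0 ≤ (if (support t ∩ support s).card = j then
        (1 / 2) ^ (2 * (2 * k + 1).choose 2 - j.choose 2) *
          (1 - 4 * q + 6 * (q ^ 2 * 2 ^ J)) ^ (n - 2 * (2 * k + 1)) else 0) := by
    intro j _
    split_ifs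
    exacts [by positivity, le_rfl]
  have hD : ∀ j ∈ Finset.Ico (J + 1) (2 * k + 1), 0 ≤
      (if (support t ∩ support s).card = j ∧ Compatible t s then
        (1 / 2) ^ (2 * (2 * k + 1).choose 2 - j.choose 2) *
          ((1 - q) ^ 2) ^ (n - 2 * (2 * k + 1)) else 0) := by
    intro j _
    split_ifs
    exacts [by positivity, le_rfl]
  have hC' := Finset.sum_nonneg hC
  have hD' := Finset.sum_nonneg hD
  by_cases hc : Compatible t s
  · rcases le_or_gt (support t ∩ support s).card J with hj | hj
    · have h1 := Finset.single_le_sum hC (Finset.mem_range.mpr (Nat.lt_succ_of_le hj))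
      rw [if_pos rfl] at h1
      have h2 := cubeProb_occurs_two_le_fine hk ht hs hj hJ
      linarith
    · have hle : (support t ∩ support s).card ≤ 2 * k + 1 :=
        card_support ht ▸ Finset.card_le_card Finset.inter_subset_left
      rcases hle.lt_or_eq with hlt | heq
      · have h1 := Finset.single_le_sum hD (Finset.mem_Ico.mpr ⟨hj, hlt⟩)
        rw [if_pos ⟨rfl, hc⟩] at h1
        have h2 := cubeProb_occurs_two_le_coarse hk ht hs
        linarith
      · have h1 : support t ∩ support s = support t :=
          Finset.eq_of_subset_of_card_le Finset.inter_subset_left (by rw [heq, card_support ht])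
        have h2 : support t = support s :=
          Finset.eq_of_subset_of_card_le (Finset.inter_eq_left.mp h1)
            (by rw [card_support ht, card_support hs])
        have h3 : cubeProb (fun ω => Occurs t ω ∧ Occurs s ω) ≤ cubeProb (Occurs t) :=
          cubeProb_mono fun ω h => h.1
        rcases hc.eq_or_eq_swap hk ht hs h2 with h | h
        · rw [if_pos h] at hA ⊢
          linarith
        · rw [if_pos h] at hB ⊢
          linarith
  · rw [cubeProb_occurs_two_eq_zero hk ht hs hc]
    linarith

theorem sum_cubeProb_occurs_two_le (hk : 0 < k) (ht : t ∈ triples n k) {J : ℕ} (hJk : J ≤ 2 * k)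
    (hJ : 6 * ((1 / 2 : ℝ) ^ k * 2 ^ J) ≤ 4) :
    ∑ s ∈ triples n k, cubeProb (fun ω => Occurs t ω ∧ Occurs s ω) ≤
      2 * cubeProb (Occurs t) +
      ∑ j ∈ Finset.range (J + 1),
        ((2 * k + 1).choose j * (n - j).choose (2 * k + 1 - j) *
          ((2 * k + 1) * (2 * k).choose k) : ℕ) *
        ((1 / 2) ^ (2 * (2 * k + 1).choose 2 - j.choose 2) *
          (1 - 4 * (1 / 2) ^ k + 6 * (((1 / 2) ^ k) ^ 2 * 2 ^ J)) ^ (n - 2 * (2 * k + 1)) : ℝ) +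
      ∑ j ∈ Finset.Ico (J + 1) (2 * k + 1),
        ((2 * k + 1).choose j * (n - j).choose (2 * k + 1 - j) *
          ((2 * k + 1) * (2 * 2 ^ (2 * k + 1 - j))) : ℕ) *
        ((1 / 2) ^ (2 * (2 * k + 1).choose 2 - j.choose 2) *
          ((1 - (1 / 2) ^ k) ^ 2) ^ (n - 2 * (2 * k + 1)) : ℝ) := by
  have hbase : (0 : ℝ) ≤ 1 - 4 * (1 / 2) ^ k + 6 * (((1 / 2) ^ k) ^ 2 * 2 ^ J) := by
    have h1 : (1 : ℝ) ≤ 2 ^ J := one_le_pow₀ (by norm_num)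
    nlinarith [mul_le_mul_of_nonneg_left h1 (sq_nonneg ((1 / 2 : ℝ) ^ k)),
      sq_nonneg (1 - 2 * (1 / 2 : ℝ) ^ k)]
  refine (Finset.sum_le_sum fun s hs => cubeProb_occurs_two_le hk ht hs hJ).trans ?_
  rw [Finset.sum_add_distrib, Finset.sum_add_distrib, Finset.sum_add_distrib]
  refine add_le_add (add_le_add ?_ ?_) ?_
  · rw [Finset.sum_ite_eq', Finset.sum_ite_eq', if_pos ht, if_pos (swapTriple_mem ht), two_mul]
  · rw [Finset.sum_comm]
    refine Finset.sum_le_sum fun j hj => ?_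
    rw [← Finset.sum_filter, Finset.sum_const, nsmul_eq_mul]
    refine mul_le_mul_of_nonneg_right (Nat.cast_le.mpr
      (card_filter_inter_triples_le ht ?_)) (by positivity)
    have := Finset.mem_range.mp hj
    omega
  · rw [Finset.sum_comm]
    refine Finset.sum_le_sum fun j hj => ?_
    rw [← Finset.sum_filter, Finset.sum_const, nsmul_eq_mul]
    exact mul_le_mul_of_nonneg_right (Nat.cast_le.mpr
      (card_filter_inter_compatible_le ht (Finset.mem_Ico.mp hj).2.le)) (by positivity)

theorem card_filter_disjoint_ge (ht : t ∈ triples n k) :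
    ((triples n k).card : ℝ) * (1 - (2 * k + 1) ^ 2 / n) ≤
      ((triples n k).filter fun s => Disjoint (support t) (support s)).card := by
  have hn : 0 < n := t.2.2.pos
  have h1 := card_filter_support (k := k) fun W => ¬ Disjoint (support t) W
  have h2 := card_filter_not_disjoint_le (card_support ht)
  have h3 := Finset.card_filter_add_card_filter_not
    (s := triples n k) fun s => Disjoint (support t) (support s)
  have h4 : n * (n - 1).choose (2 * k) = n.choose (2 * k + 1) * (2 * k + 1) := by
    have := Nat.add_one_mul_choose_eq (n - 1) (2 * k)
    rwa [Nat.sub_add_cancel hn] at this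
  have h5 : n * ((triples n k).filter fun s => ¬ Disjoint (support t) (support s)).card ≤
      (2 * k + 1) ^ 2 * (triples n k).card := by
    rw [h1, card_triples]
    calc _ ≤ n * (((2 * k + 1) * (n - 1).choose (2 * k)) * ((2 * k + 1) * (2 * k).choose k)) :=
          Nat.mul_le_mul_left _ (Nat.mul_le_mul_right _ h2)
      _ = (2 * k + 1) * (n * (n - 1).choose (2 * k)) * ((2 * k + 1) * (2 * k).choose k) := by ring
      _ = _ := by rw [h4]; ring
  have h3' : (((triples n k).filter fun s => Disjoint (support t) (support s)).card : ℝ) +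
      ((triples n k).filter fun s => ¬ Disjoint (support t) (support s)).card =
      (triples n k).card := by exact_mod_cast h3
  have h5' : (n : ℝ) * ((triples n k).filter fun s => ¬ Disjoint (support t) (support s)).card ≤
      (2 * k + 1) ^ 2 * (triples n k).card := by exact_mod_cast h5
  have hn' : (0 : ℝ) < n := by exact_mod_cast hn
  have h6 : (((triples n k).filter fun s => ¬ Disjoint (support t) (support s)).card : ℝ) ≤
      (2 * k + 1) ^ 2 * (triples n k).card / n := by
    rw [le_div_iff₀ hn']
    linarith
  have h7 : ((triples n k).card : ℝ) * (1 - (2 * k + 1) ^ 2 / n) =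
    (triples n k).card - (2 * k + 1) ^ 2 * (triples n k).card / n := by ring
  linarith

theorem sum_cubeProb_occurs_two_ge (hk : 0 < k) (ht : t ∈ triples n k)
    (hkq : 4 * (2 * k + 1) * (1 / 2 : ℝ) ^ k ≤ 1) :
    2 * cubeProb (Occurs t) + ((triples n k).card : ℝ) * (1 - (2 * k + 1) ^ 2 / n) *
      (((1 / 2 : ℝ) ^ (2 * k + 1).choose 2) ^ 2 * (1 - 4 * (2 * k + 1) * (1 / 2) ^ k) *
        (((1 - (1 / 2) ^ k) ^ 2) ^ (n - 2 * (2 * k + 1))) ^ 2) ≤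
    ∑ s ∈ triples n k, cubeProb (fun ω => Occurs t ω ∧ Occurs s ω) := by
  set D := (triples n k).filter fun s => Disjoint (support t) (support s) with hD
  have hx : t.2.2 ∈ support t := mem_support.mpr (Or.inl rfl)
  have hx' : t.2.2 ∈ support (swapTriple t) := mem_support.mpr (Or.inl rfl)
  have htD : t ∉ D := fun h =>
    Finset.disjoint_left.mp (Finset.mem_filter.mp h).2 hx hx
  have hsD : swapTriple t ∉ D := fun h =>
    Finset.disjoint_left.mp (Finset.mem_filter.mp h).2 hx hx'
  have hne : t ∉ insert (swapTriple t) D := by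
    rw [Finset.mem_insert, not_or]
    exact ⟨(swapTriple_ne hk ht).symm, htD⟩
  have hsub : insert t (insert (swapTriple t) D) ⊆ triples n k := by
    intro s hs
    rcases Finset.mem_insert.mp hs with rfl | hs
    · exact ht
    rcases Finset.mem_insert.mp hs with rfl | hs
    · exact swapTriple_mem ht
    · exact (Finset.mem_filter.mp hs).1
  refine le_trans ?_ (Finset.sum_le_sum_of_subset_of_nonneg hsub fun s _ _ => cubeProb_nonneg _)
  rw [Finset.sum_insert hne, Finset.sum_insert hsD,
    cubeProb_congr (q := Occurs t) fun ω => and_self_iff,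
    cubeProb_congr (p := fun ω => Occurs t ω ∧ Occurs (swapTriple t) ω) (q := Occurs t)
      fun ω => by rw [occurs_swapTriple, and_self_iff]]
  have h1 : ((triples n k).card : ℝ) * (1 - (2 * k + 1) ^ 2 / n) *
      (((1 / 2 : ℝ) ^ (2 * k + 1).choose 2) ^ 2 * (1 - 4 * (2 * k + 1) * (1 / 2) ^ k) *
        (((1 - (1 / 2) ^ k) ^ 2) ^ (n - 2 * (2 * k + 1))) ^ 2) ≤
      ∑ s ∈ D, cubeProb (fun ω => Occurs t ω ∧ Occurs s ω) := by
    calc _ ≤ (D.card : ℝ) *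
      (((1 / 2 : ℝ) ^ (2 * k + 1).choose 2) ^ 2 * (1 - 4 * (2 * k + 1) * (1 / 2) ^ k) *
        (((1 - (1 / 2) ^ k) ^ 2) ^ (n - 2 * (2 * k + 1))) ^ 2) := by
          refine mul_le_mul_of_nonneg_right (card_filter_disjoint_ge ht) ?_
          have := sub_nonneg.mpr hkq
          positivity
      _ ≤ _ := by
          rw [← nsmul_eq_mul]
          refine Finset.card_nsmul_le_sum _ _ _ fun s hs => ?_
          obtain ⟨hs, hd⟩ := Finset.mem_filter.mp hs
          exact cubeProb_occurs_two_ge hk ht hs hd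
  linarith

end PairSums

section Estimates

theorem choose_mul_pow_le {m n : ℕ} (hmn : m ≤ n) (j : ℕ) :
    m.choose j * n ^ j ≤ n.choose j * m ^ j := by
  induction j with
  | zero => simp
  | succ j ih =>
    have h1 : (m - j) * n ≤ (n - j) * m := by
      rw [Nat.sub_mul, Nat.sub_mul, Nat.mul_comm n m]
      exact Nat.sub_le_sub_left (Nat.mul_le_mul_left _ hmn) _
    refine Nat.le_of_mul_le_mul_right ?_ j.succ_pos
    calc m.choose (j + 1) * n ^ (j + 1) * (j + 1)
        = (m.choose (j + 1) * (j + 1)) * n ^ j * n := by ring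
      _ = (m.choose j * n ^ j) * ((m - j) * n) := by rw [Nat.choose_succ_right_eq]; ring
      _ ≤ (n.choose j * m ^ j) * ((n - j) * m) := Nat.mul_le_mul ih h1
      _ = (n.choose (j + 1) * (j + 1)) * m ^ j * m := by rw [Nat.choose_succ_right_eq]; ring
      _ = n.choose (j + 1) * m ^ (j + 1) * (j + 1) := by ring

theorem choose_mul_choose_sub_le {m n j : ℕ} (hjm : j ≤ m) (hmn : m ≤ n) (hn : 0 < n) :
    (m.choose j * (n - j).choose (m - j) : ℝ) ≤ n.choose m * ((m : ℝ) ^ 2 / n) ^ j := by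
  have hn' : (0 : ℝ) < n := by exact_mod_cast hn
  have h1 : m.choose j * n ^ j ≤ n.choose j * m ^ j := choose_mul_pow_le hmn j
  have h2 : n.choose m * m.choose j = n.choose j * (n - j).choose (m - j) :=
    Nat.choose_mul hjm
  have h3 : m.choose j ≤ m ^ j := Nat.choose_le_pow m j
  have h4 : 0 < n.choose j := Nat.choose_pos (hjm.trans hmn)
  rw [div_pow, ← mul_div_assoc, le_div_iff₀ (by positivity)]
  have h5 : m.choose j * (n - j).choose (m - j) * n ^ j ≤ n.choose m * (m ^ 2) ^ j := by
    refine Nat.le_of_mul_le_mul_left ?_ h4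
    calc n.choose j * (m.choose j * (n - j).choose (m - j) * n ^ j)
        = (n.choose j * (n - j).choose (m - j)) * (m.choose j * n ^ j) := by ring
      _ ≤ (n.choose j * (n - j).choose (m - j)) * (n.choose j * m ^ j) :=
        Nat.mul_le_mul_left _ h1
      _ = n.choose m * m.choose j * (n.choose j * m ^ j) := by rw [h2]
      _ ≤ n.choose m * m ^ j * (n.choose j * m ^ j) := by gcongr
      _ = n.choose j * (n.choose m * (m ^ 2) ^ j) := by ring
  exact_mod_cast h5

theorem choose_two_le_mul {h j : ℕ} (hj : j ≤ 2 * h) : j.choose 2 ≤ j * h := by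
  rw [Nat.choose_two_right]
  refine Nat.div_le_of_le_mul ?_
  calc j * (j - 1) ≤ j * (2 * h) := Nat.mul_le_mul_left _ (by omega)
    _ = 2 * (j * h) := by ring

theorem choose_two_add_le {k h j : ℕ} (hj : 2 * h < j) (hjk : j ≤ 2 * k + 1) :
    j.choose 2 + (2 * k + 1 - j) * (k + h) ≤ (2 * k + 1).choose 2 := by
  obtain ⟨r, hr⟩ := Nat.exists_eq_add_of_le hjk
  rw [hr, Nat.add_sub_cancel_left, Nat.choose_two_right, Nat.choose_two_right]
  have h1 : 2 ∣ j * (j - 1) := (Nat.even_mul_pred_self j).two_dvd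
  have h2 : 2 ∣ (j + r) * (j + r - 1) := (Nat.even_mul_pred_self (j + r)).two_dvd
  have h3 : j * (j - 1) + r * (2 * (k + h)) ≤ (j + r) * (j + r - 1) := by
    obtain ⟨i, rfl⟩ : ∃ i, j = i + 1 := ⟨j - 1, by omega⟩
    have e : i + 1 + r - 1 = i + r := by omega
    rw [e, Nat.add_sub_cancel]
    have : r * (2 * (k + h)) ≤ r * (2 * i + 1 + r) := Nat.mul_le_mul_left _ (by omega)
    nlinarith
  have h4 : r * (2 * (k + h)) = 2 * (r * (k + h)) := by ring
  omega

theorem one_half_pow_sub {a b : ℕ} (h : b ≤ a) : (1 / 2 : ℝ) ^ (a - b) = (1 / 2) ^ a * 2 ^ b := by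
  obtain ⟨c, rfl⟩ := Nat.exists_eq_add_of_le h
  rw [Nat.add_sub_cancel_left, pow_add, mul_right_comm, ← mul_pow]
  norm_num

theorem choose_two_mono {j m : ℕ} (h : j ≤ m) : j.choose 2 ≤ 2 * m.choose 2 :=
  (Nat.choose_le_choose 2 h).trans (by omega)

theorem fine_term_le {n k h j : ℕ} (hj : j ≤ 2 * h) (hjk : j ≤ 2 * k + 1) (hn : 2 * k + 1 ≤ n) :
    (((2 * k + 1).choose j * (n - j).choose (2 * k + 1 - j) *
        ((2 * k + 1) * (2 * k).choose k) : ℕ) : ℝ) *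
      (1 / 2) ^ (2 * (2 * k + 1).choose 2 - j.choose 2) ≤
    (n.choose (2 * k + 1) * ((2 * k + 1) * (2 * k).choose k) : ℕ) *
      ((1 / 2) ^ (2 * k + 1).choose 2) ^ 2 * ((2 * k + 1) ^ 2 / n * 2 ^ h) ^ j := by
  have h1 := choose_mul_choose_sub_le hjk hn (by omega)
  have h2 : (2 : ℝ) ^ j.choose 2 ≤ (2 ^ h) ^ j := by
    rw [← pow_mul, mul_comm h j]
    exact pow_le_pow_right₀ (by norm_num) (choose_two_le_mul hj)
  rw [one_half_pow_sub (choose_two_mono hjk), ← pow_mul, mul_comm ((2 * k + 1).choose 2) 2, mul_pow]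
  push_cast at h1 ⊢
  calc _ = (((2 * k + 1).choose j : ℝ) * (n - j).choose (2 * k + 1 - j)) *
        ((2 * k + 1) * (2 * k).choose k * (1 / 2) ^ (2 * (2 * k + 1).choose 2)) *
          2 ^ j.choose 2 := by ring
    _ ≤ (n.choose (2 * k + 1) * ((2 * k + 1) ^ 2 / n) ^ j) *
        ((2 * k + 1) * (2 * k).choose k * (1 / 2) ^ (2 * (2 * k + 1).choose 2)) *
          (2 ^ h) ^ j := by gcongr
    _ = _ := by ring

theorem coarse_term_le {k h j : ℕ} (hj : 2 * h < j) (hjk : j ≤ 2 * k + 1) :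
    (((2 * k + 1).choose j * (2 ^ k * k - j).choose (2 * k + 1 - j) *
        ((2 * k + 1) * (2 * 2 ^ (2 * k + 1 - j))) : ℕ) : ℝ) *
      (1 / 2) ^ (2 * (2 * k + 1).choose 2 - j.choose 2) ≤
    (1 / 2) ^ (2 * k + 1).choose 2 * (2 * (2 * k + 1)) *
      (2 * (2 * k + 1) * k * (1 / 2) ^ h) ^ (2 * k + 1 - j) := by
  have h1 : (2 * k + 1).choose j ≤ (2 * k + 1) ^ (2 * k + 1 - j) := by
    rw [← Nat.choose_symm hjk]
    exact Nat.choose_le_pow _ _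
  have h2 : (2 ^ k * k - j).choose (2 * k + 1 - j) ≤ (2 ^ k * k) ^ (2 * k + 1 - j) :=
    (Nat.choose_le_pow _ _).trans (Nat.pow_le_pow_left (Nat.sub_le _ _) _)
  have h3 := choose_two_add_le hj hjk
  have h4 : (1 / 2 : ℝ) ^ (2 * (2 * k + 1).choose 2 - j.choose 2) ≤
      (1 / 2) ^ (2 * k + 1).choose 2 * ((1 / 2) ^ (k + h)) ^ (2 * k + 1 - j) := by
    rw [← pow_mul, ← pow_add]
    refine pow_le_pow_of_le_one (by norm_num) (by norm_num) ?_
    rw [mul_comm (k + h)]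
    omega
  have h1' : ((2 * k + 1).choose j : ℝ) ≤ (2 * k + 1) ^ (2 * k + 1 - j) := by exact_mod_cast h1
  have h2' : ((2 ^ k * k - j).choose (2 * k + 1 - j) : ℝ) ≤ (2 ^ k * k) ^ (2 * k + 1 - j) := by
    exact_mod_cast h2
  push_cast
  calc _ ≤ ((2 * k + 1 : ℝ) ^ (2 * k + 1 - j) * (2 ^ k * k) ^ (2 * k + 1 - j) *
        ((2 * k + 1) * (2 * 2 ^ (2 * k + 1 - j)))) *
        ((1 / 2) ^ (2 * k + 1).choose 2 * ((1 / 2) ^ (k + h)) ^ (2 * k + 1 - j)) := by gcongr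
    _ = (1 / 2) ^ (2 * k + 1).choose 2 * (2 * (2 * k + 1)) *
      ((2 * k + 1) * (2 ^ k * k) * 2 * (1 / 2) ^ (k + h)) ^ (2 * k + 1 - j) := by
        simp only [mul_pow]; ring
    _ = _ := by
        congr 2
        have : (2 : ℝ) ^ k * (1 / 2) ^ k = 1 := by rw [← mul_pow]; norm_num
        rw [pow_add]
        linear_combination (2 * k + 1) * k * 2 * (1 / 2) ^ h * this

theorem sum_range_pow_le {ρ : ℝ} (h0 : 0 ≤ ρ) (h1 : ρ ≤ 1) (J : ℕ) :
    ∑ j ∈ Finset.range (J + 1), ρ ^ j ≤ 1 + J * ρ := by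
  rw [Finset.sum_range_succ']
  have : ∑ j ∈ Finset.range J, ρ ^ (j + 1) ≤ ∑ _j ∈ Finset.range J, ρ :=
    Finset.sum_le_sum fun j _ => by
      simpa using pow_le_pow_of_le_one h0 h1 (Nat.le_add_left 1 j)
  rw [Finset.sum_const, Finset.card_range, nsmul_eq_mul] at this
  simp only [pow_zero]
  linarith

theorem sum_Ico_pow_sub_le {ρ : ℝ} (h0 : 0 ≤ ρ) (h1 : ρ ≤ 1) (a m : ℕ) :
    ∑ j ∈ Finset.Ico a m, ρ ^ (m - j) ≤ m * ρ := by
  calc ∑ j ∈ Finset.Ico a m, ρ ^ (m - j) ≤ ∑ j ∈ Finset.Ico a m, ρ := by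
        refine Finset.sum_le_sum fun j hj => ?_
        have := (Finset.mem_Ico.mp hj).2
        simpa using pow_le_pow_of_le_one h0 h1 (show 1 ≤ m - j by omega)
    _ = ((m - a : ℕ) : ℝ) * ρ := by simp
    _ ≤ m * ρ := by
        gcongr
        exact Nat.sub_le _ _

end Estimates

section SmallError

/-- A null sequence dominating every error term of the second moment computation. -/
noncomputable def smallError (k : ℕ) : ℝ :=
  16384 * (((k / 4 : ℕ) + 1 : ℝ) ^ 4 * (1 / 2) ^ (k / 4))

theorem tendsto_smallError : Tendsto smallError atTop (nhds 0) := by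
  have h1 : Tendsto (fun h : ℕ => ((h + 1 : ℕ) : ℝ) ^ 4 * (1 / 2 : ℝ) ^ (h + 1)) atTop (nhds 0) :=
    (tendsto_add_atTop_iff_nat 1).mpr
      (tendsto_pow_const_mul_const_pow_of_abs_lt_one 4
        (by rw [abs_of_pos] <;> norm_num : |(1 / 2 : ℝ)| < 1))
  have h2 : Tendsto (fun k : ℕ => k / 4) atTop atTop :=
    Nat.tendsto_div_const_atTop (by norm_num)
  have h3 := (h1.comp h2).const_mul 32768
  rw [mul_zero] at h3
  refine h3.congr fun k => ?_
  simp only [smallError, Function.comp_apply]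
  push_cast
  ring

theorem smallError_bounds {k : ℕ} (hk : 0 < k) :
    4 * (2 * k + 1) * (1 / 2 : ℝ) ^ k ≤ smallError k ∧
    (2 * k + 1 : ℝ) ^ 2 / ((2 ^ k * k : ℕ) : ℝ) ≤ smallError k ∧
    8 * (2 * k + 1) * (1 / 2 : ℝ) ^ k + 6 * k * ((1 / 2) ^ k * 2 ^ (2 * (k / 4))) ≤ smallError k ∧
    ((2 * (k / 4) : ℕ) + 1 : ℝ) * ((2 * k + 1 : ℝ) ^ 2 / ((2 ^ k * k : ℕ) : ℝ) * 2 ^ (k / 4)) ≤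
      smallError k ∧
    2 * (2 * k + 1 : ℝ) ^ 2 * (2 * (2 * k + 1) * k * (1 / 2) ^ (k / 4)) ≤ smallError k := by
  have hkh : k ≤ 4 * (k / 4 + 1) := by omega
  have hkh' : 4 * (k / 4) ≤ k := by omega
  unfold smallError
  generalize k / 4 = h at *
  set H : ℝ := (h : ℝ) + 1 with hH
  set x : ℝ := (1 / 2) ^ h with hx
  have hx0 : 0 < x := by positivity
  have hx1 : x ≤ 1 := pow_le_one₀ (by norm_num) (by norm_num)
  have hH1 : 1 ≤ H := by simp [hH]
  have hxz : (2 : ℝ) ^ h * x = 1 := by rw [hx, ← mul_pow]; norm_num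
  have hq : (1 / 2 : ℝ) ^ k ≤ x ^ 4 := by
    rw [hx, ← pow_mul]
    exact pow_le_pow_of_le_one (by norm_num) (by norm_num) (by omega)
  set q : ℝ := (1 / 2) ^ k with hqdef
  have hq0 : 0 < q := by positivity
  have hqn : (2 : ℝ) ^ k * q = 1 := by rw [hqdef, ← mul_pow]; norm_num
  have hk1 : (1 : ℝ) ≤ k := by exact_mod_cast hk
  have hkH : (k : ℝ) ≤ 4 * H := by rw [hH]; exact_mod_cast hkh
  have hm : (2 * k + 1 : ℝ) ≤ 8 * H + 1 := by linarith
  have hm' : (2 * k + 1 : ℝ) ≤ 9 * H := by linarith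
  have hqx : q ≤ x := hq.trans (pow_le_of_le_one hx0.le hx1 (by norm_num))
  have hH2 : H ≤ H ^ 4 := le_self_pow₀ hH1 (by norm_num)
  have hH3 : H ^ 2 ≤ H ^ 4 := pow_le_pow_right₀ hH1 (by norm_num)
  have hH4 : H ^ 3 ≤ H ^ 4 := pow_le_pow_right₀ hH1 (by norm_num)
  have hqz : q * 2 ^ (2 * h) ≤ x := by
    calc q * 2 ^ (2 * h) ≤ x ^ 4 * 2 ^ (2 * h) := by gcongr
      _ = x ^ 2 * (2 ^ h * x) ^ 2 := by rw [mul_comm 2 h, pow_mul]; ring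
      _ ≤ x := by
        rw [hxz, one_pow, mul_one]
        exact pow_le_of_le_one hx0.le hx1 (by norm_num)
  have hdiv : (2 * k + 1 : ℝ) ^ 2 / ((2 ^ k * k : ℕ) : ℝ) ≤ (9 * H) ^ 2 * q := by
    rw [div_le_iff₀ (by positivity)]
    push_cast
    calc (2 * k + 1 : ℝ) ^ 2 ≤ (9 * H) ^ 2 := by gcongr
      _ ≤ (9 * H) ^ 2 * k := le_mul_of_one_le_right (by positivity) hk1
      _ = (9 * H) ^ 2 * q * (2 ^ k * k) := by linear_combination (-(9 * H) ^ 2 * k) * hqn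
  have hHx : H * x ≤ H ^ 4 * x := by gcongr
  refine ⟨?_, ?_, ?_, ?_, ?_⟩
  · calc 4 * (2 * k + 1) * q ≤ 4 * (9 * H) * x := by gcongr
      _ = 36 * (H * x) := by ring
      _ ≤ 16384 * (H ^ 4 * x) := by nlinarith [mul_pos (zero_lt_one.trans_le hH1) hx0]
  · calc _ ≤ (9 * H) ^ 2 * q := hdiv
      _ ≤ (9 * H) ^ 2 * x := by gcongr
      _ = 81 * (H ^ 2 * x) := by ring
      _ ≤ 81 * (H ^ 4 * x) := by gcongr
      _ ≤ 16384 * (H ^ 4 * x) := by gcongr; norm_num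
  · calc 8 * (2 * k + 1) * q + 6 * k * (q * 2 ^ (2 * h))
        ≤ 8 * (9 * H) * x + 6 * (4 * H) * x := by gcongr
      _ = 96 * (H * x) := by ring
      _ ≤ 96 * (H ^ 4 * x) := by gcongr
      _ ≤ 16384 * (H ^ 4 * x) := by gcongr; norm_num
  · have h1 : ((2 * h : ℕ) + 1 : ℝ) ≤ 2 * H := by push_cast; linarith
    calc _ ≤ 2 * H * ((9 * H) ^ 2 * x ^ 4 * 2 ^ h) := by
          gcongr
          exact hdiv.trans (by gcongr)
      _ = 162 * (H ^ 3 * (x ^ 3 * (2 ^ h * x))) := by ring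
      _ ≤ 162 * (H ^ 4 * x) := by
          rw [hxz, mul_one]
          gcongr
          exact pow_le_of_le_one hx0.le hx1 (by norm_num)
      _ ≤ 16384 * (H ^ 4 * x) := by gcongr; norm_num
  · calc _ ≤ 2 * (9 * H) ^ 2 * (2 * (9 * H) * (4 * H) * x) := by gcongr
      _ = 11664 * (H ^ 4 * x) := by ring
      _ ≤ 16384 * (H ^ 4 * x) := by gcongr; norm_num

end SmallError

section SecondMoment

theorem one_sub_sq_pow_le (k m : ℕ) :
    ((1 - (1 / 2 : ℝ) ^ k) ^ 2) ^ (2 ^ k * k - m) ≤ exp (2 * m * (1 / 2) ^ k - 2 * k) := by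
  set q : ℝ := (1 / 2) ^ k with hq
  have hq1 : q ≤ 1 := one_half_pow_le_one k
  have hqn : (2 : ℝ) ^ k * q = 1 := by rw [hq, ← mul_pow]; norm_num
  have h1 : 1 - q ≤ exp (-q) := Real.one_sub_le_exp_neg q
  have h2 : (2 ^ k * k : ℝ) - m ≤ ((2 ^ k * k - m : ℕ) : ℝ) := by
    rw [sub_le_iff_le_add]
    exact_mod_cast (by omega : 2 ^ k * k ≤ (2 ^ k * k - m) + m)
  have hq0 : 0 < q := by positivity
  rw [← pow_mul]
  calc (1 - q) ^ (2 * (2 ^ k * k - m)) ≤ exp (-q) ^ (2 * (2 ^ k * k - m)) :=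
        pow_le_pow_left₀ (by linarith) h1 _
    _ = exp (-(2 * q) * ((2 ^ k * k - m : ℕ) : ℝ)) := by
        rw [← Real.exp_nat_mul]
        push_cast
        congr 1
        ring
    _ ≤ _ := by
        rw [Real.exp_le_exp]
        have h3 : 2 * q * ((2 ^ k * k : ℝ) - m) ≤ 2 * q * ((2 ^ k * k - m : ℕ) : ℝ) := by gcongr
        linear_combination h3 - 2 * k * hqn

theorem le_one_sub_sq_pow {k : ℕ} (hk : 0 < k) (m : ℕ) :
    exp (-(4 * k * (1 / 2) ^ k) - 2 * k) ≤ ((1 - (1 / 2 : ℝ) ^ k) ^ 2) ^ (2 ^ k * k - m) := by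
  have hq2 : (1 / 2 : ℝ) ^ k ≤ 1 / 2 := pow_le_of_le_one (by norm_num) (by norm_num) hk.ne'
  set q : ℝ := (1 / 2) ^ k with hq
  have hq0 : 0 < q := by positivity
  have hqn : (2 : ℝ) ^ k * q = 1 := by rw [hq, ← mul_pow]; norm_num
  have h1 : exp (-(q + 2 * q ^ 2)) ≤ 1 - q := by
    rw [Real.exp_neg]
    refine inv_le_of_inv_le₀ (by linarith) (le_trans ?_ (Real.add_one_le_exp _))
    rw [inv_le_iff_one_le_mul₀ (by linarith)]
    nlinarith [mul_pos hq0 hq0]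
  calc exp (-(4 * k * q) - 2 * k) = exp (-(q + 2 * q ^ 2)) ^ (2 * (2 ^ k * k)) := by
        rw [← Real.exp_nat_mul]
        push_cast
        congr 1
        linear_combination (2 * k + 4 * q * k) * hqn
    _ ≤ (1 - q) ^ (2 * (2 ^ k * k)) := pow_le_pow_left₀ (Real.exp_pos _).le h1 _
    _ = ((1 - q) ^ 2) ^ (2 ^ k * k) := pow_mul _ _ _
    _ ≤ _ := pow_le_pow_of_le_one (by positivity)
        (pow_le_one₀ (by linarith) (by linarith)) (Nat.sub_le _ _)

theorem one_sub_four_mul_pow_le {k m J : ℕ} (hJ : 6 * ((1 / 2 : ℝ) ^ k * 2 ^ J) ≤ 4) :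
    (1 - 4 * (1 / 2 : ℝ) ^ k + 6 * (((1 / 2) ^ k) ^ 2 * 2 ^ J)) ^ (2 ^ k * k - m) ≤
      exp (4 * m * (1 / 2) ^ k + 6 * k * ((1 / 2) ^ k * 2 ^ J) - 4 * k) := by
  set q : ℝ := (1 / 2) ^ k with hq
  have hqn : (2 : ℝ) ^ k * q = 1 := by rw [hq, ← mul_pow]; norm_num
  have hq0 : 0 < q := by positivity
  set y : ℝ := q * 2 ^ J with hy
  have hy0 : 0 < y := by positivity
  have hqy : q ^ 2 * 2 ^ J = q * y := by rw [hy]; ring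
  rw [hqy]
  have hbase : 0 ≤ 1 - 4 * q + 6 * (q * y) := by
    have h1 : (1 : ℝ) ≤ 2 ^ J := one_le_pow₀ (by norm_num)
    have h2 : q ≤ y := le_mul_of_one_le_right hq0.le h1
    nlinarith [mul_le_mul_of_nonneg_left h2 hq0.le, sq_nonneg (1 - 2 * q)]
  have h1 : 1 - 4 * q + 6 * (q * y) ≤ exp (-(q * (4 - 6 * y))) := by
    have := Real.one_sub_le_exp_neg (q * (4 - 6 * y))
    linarith
  have h2 : (2 ^ k * k : ℝ) - m ≤ ((2 ^ k * k - m : ℕ) : ℝ) := by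
    rw [sub_le_iff_le_add]
    exact_mod_cast (by omega : 2 ^ k * k ≤ (2 ^ k * k - m) + m)
  calc _ ≤ exp (-(q * (4 - 6 * y))) ^ (2 ^ k * k - m) := pow_le_pow_left₀ hbase h1 _
    _ = exp (-(q * (4 - 6 * y)) * ((2 ^ k * k - m : ℕ) : ℝ)) := by
        rw [← Real.exp_nat_mul]
        congr 1
        ring
    _ ≤ _ := by
        rw [Real.exp_le_exp]
        have h3 : q * (4 - 6 * y) * ((2 ^ k * k : ℝ) - m) ≤
            q * (4 - 6 * y) * ((2 ^ k * k - m : ℕ) : ℝ) :=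
          mul_le_mul_of_nonneg_left h2 (mul_nonneg hq0.le (by linarith))
        have h4 : 0 ≤ 6 * (y * q * m) := by positivity
        linear_combination h3 + h4 - (4 - 6 * y) * k * hqn

/-- The main term of the number of candidates, rescaled: half of its limit is the limiting mean. -/
noncomputable def scaledCount (k : ℕ) : ℝ :=
  (triples (2 ^ k * k) k).card * (1 / 2) ^ (2 * k + 1).choose 2 * exp (-(2 * k))

theorem scaledCount_mul_exp (k : ℕ) :
    ((triples (2 ^ k * k) k).card : ℝ) * (1 / 2) ^ (2 * k + 1).choose 2 =
      scaledCount k * exp (2 * k) := by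
  rw [scaledCount, mul_assoc, ← Real.exp_add, neg_add_cancel, Real.exp_zero, mul_one]

theorem scaledCount_nonneg (k : ℕ) : 0 ≤ scaledCount k := by
  unfold scaledCount
  positivity

theorem second_moment_le {k : ℕ} (hk : 0 < k) (hE : smallError k ≤ 1) :
    ∑ t ∈ triples (2 ^ k * k) k, ∑ s ∈ triples (2 ^ k * k) k,
        cubeProb (fun ω => Occurs t ω ∧ Occurs s ω) ≤
      2 * (scaledCount k * exp (smallError k)) +
        scaledCount k ^ 2 * exp (smallError k) * (1 + smallError k) +
        scaledCount k * exp (smallError k) * smallError k := by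
  obtain ⟨e1, e2, e3, e4, e5⟩ := smallError_bounds hk
  set E := smallError k with hEdef
  set h := k / 4 with hh
  set n := 2 ^ k * k with hn
  set q : ℝ := (1 / 2) ^ k with hq
  set Q := scaledCount k with hQ
  have hQ0 : 0 ≤ Q := scaledCount_nonneg k
  have hk1 : (1 : ℝ) ≤ k := by exact_mod_cast hk
  have hq0 : 0 < q := by positivity
  have hJ : 6 * (q * 2 ^ (2 * h)) ≤ 4 := by
    have h1 : 0 < q * 2 ^ (2 * h) := by positivity
    have h2 : 0 < 8 * (2 * k + 1) * q := by positivity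
    nlinarith
  have hmn : 2 * k + 1 ≤ n := by
    have h1 : (2 * k + 1 : ℝ) * q ≤ 1 := by nlinarith
    have h2 : (2 : ℝ) ^ k * q = 1 := by rw [hq, ← mul_pow]; norm_num
    have h3 : (2 * k + 1 : ℝ) ≤ 2 ^ k := by
      exact le_of_mul_le_mul_right (h1.trans_eq h2.symm) hq0
    have h4 : 2 * k + 1 ≤ 2 ^ k := by exact_mod_cast h3
    exact h4.trans (Nat.le_mul_of_pos_right _ hk)
  set ρ₁ : ℝ := (2 * k + 1) ^ 2 / n * 2 ^ h with hρ₁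
  set ρ₂ : ℝ := 2 * (2 * k + 1) * k * (1 / 2) ^ h with hρ₂
  have hE0 : 0 ≤ E := le_trans (by positivity) e1
  have hρ₁0 : 0 ≤ ρ₁ := by positivity
  have hρ₂0 : 0 ≤ ρ₂ := by positivity
  have hρ₁1 : ρ₁ ≤ 1 := by
    have : 0 ≤ ((2 * h : ℕ) : ℝ) * ρ₁ := by positivity
    linarith
  have hρ₁E : ((2 * h : ℕ) : ℝ) * ρ₁ ≤ E := by linarith
  have hρ₂1 : ρ₂ ≤ 1 := by nlinarith [mul_nonneg hρ₂0 (by positivity : (0 : ℝ) ≤ k ^ 2 + k)]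
  set N : ℝ := ((triples n k).card : ℝ) with hN
  set w : ℝ := (1 / 2) ^ (2 * k + 1).choose 2 with hw
  have hNw : N * w = Q * exp (2 * k) := scaledCount_mul_exp k
  set A : ℝ := ((1 - q) ^ 2) ^ (n - 2 * (2 * k + 1)) with hA
  set B : ℝ := (1 - 4 * q + 6 * (q ^ 2 * 2 ^ (2 * h))) ^ (n - 2 * (2 * k + 1)) with hB
  have hA0 : 0 ≤ A := by positivity
  have hB0 : 0 ≤ B := by
    have h1 : (1 : ℝ) ≤ 2 ^ (2 * h) := one_le_pow₀ (by norm_num)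
    refine pow_nonneg ?_ _
    nlinarith [mul_le_mul_of_nonneg_left h1 (sq_nonneg q), sq_nonneg (1 - 2 * q)]
  have hA1 : ((1 - q) ^ 2) ^ (n - (2 * k + 1)) ≤ exp (E - 2 * k) := by
    refine (one_sub_sq_pow_le k _).trans (Real.exp_le_exp.mpr ?_)
    push_cast
    have : 0 ≤ 2 * (2 * k + 1) * q := by positivity
    linarith
  have hA2 : A ≤ exp (E - 2 * k) := by
    refine (one_sub_sq_pow_le k _).trans (Real.exp_le_exp.mpr ?_)
    push_cast
    linarith
  have hB1 : B ≤ exp (E - 4 * k) := by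
    refine (one_sub_four_mul_pow_le hJ).trans (Real.exp_le_exp.mpr ?_)
    push_cast
    linarith
  have hfine : ∀ j ∈ Finset.range (2 * h + 1),
      (((2 * k + 1).choose j * (n - j).choose (2 * k + 1 - j) *
        ((2 * k + 1) * (2 * k).choose k) : ℕ) : ℝ) *
        ((1 / 2) ^ (2 * (2 * k + 1).choose 2 - j.choose 2) * B) ≤ N * w ^ 2 * ρ₁ ^ j * B := by
    intro j hj
    have hj' := Finset.mem_range.mp hj
    rw [← mul_assoc, hN, card_triples]
    exact mul_le_mul_of_nonneg_right (fine_term_le (by omega) (by omega) hmn) hB0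
  have hcoarse : ∀ j ∈ Finset.Ico (2 * h + 1) (2 * k + 1),
      (((2 * k + 1).choose j * (n - j).choose (2 * k + 1 - j) *
        ((2 * k + 1) * (2 * 2 ^ (2 * k + 1 - j))) : ℕ) : ℝ) *
        ((1 / 2) ^ (2 * (2 * k + 1).choose 2 - j.choose 2) * A) ≤
      w * (2 * (2 * k + 1)) * ρ₂ ^ (2 * k + 1 - j) * A := by
    intro j hj
    obtain ⟨hj1, hj2⟩ := Finset.mem_Ico.mp hj
    rw [← mul_assoc]
    exact mul_le_mul_of_nonneg_right (coarse_term_le (by omega) hj2.le) hA0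
  have hterm : ∀ t ∈ triples n k, ∑ s ∈ triples n k, cubeProb (fun ω => Occurs t ω ∧ Occurs s ω) ≤
      2 * (w * exp (E - 2 * k)) + N * w ^ 2 * (1 + E) * exp (E - 4 * k) +
        w * E * exp (E - 2 * k) := by
    intro t ht
    refine (sum_cubeProb_occurs_two_le hk ht (J := 2 * h) (by omega) hJ).trans ?_
    refine add_le_add (add_le_add ?_ ?_) ?_
    · rw [cubeProb_occurs hk ht]
      gcongr
    · refine (Finset.sum_le_sum hfine).trans ?_
      rw [← Finset.sum_mul, ← Finset.mul_sum]
      have := (sum_range_pow_le hρ₁0 hρ₁1 (2 * h)).trans (add_le_add_right hρ₁E 1)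
      gcongr
    · refine (Finset.sum_le_sum hcoarse).trans ?_
      rw [← Finset.sum_mul, ← Finset.mul_sum]
      have h1 := sum_Ico_pow_sub_le hρ₂0 hρ₂1 (2 * h + 1) (2 * k + 1)
      push_cast at h1
      have h2 : 2 * (2 * k + 1) * ∑ j ∈ Finset.Ico (2 * h + 1) (2 * k + 1), ρ₂ ^ (2 * k + 1 - j) ≤
          E := by
        refine le_trans ?_ e5
        calc _ ≤ 2 * (2 * k + 1) * ((2 * k + 1) * ρ₂) := by gcongr
          _ = _ := by ring
      rw [mul_assoc w]
      gcongr
  calc _ ≤ ∑ t ∈ triples n k, (2 * (w * exp (E - 2 * k)) +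
        N * w ^ 2 * (1 + E) * exp (E - 4 * k) + w * E * exp (E - 2 * k)) := Finset.sum_le_sum hterm
    _ = 2 * ((N * w) * exp (E - 2 * k)) + (N * w) ^ 2 * (1 + E) * exp (E - 4 * k) +
        (N * w) * E * exp (E - 2 * k) := by
        rw [Finset.sum_const, nsmul_eq_mul]
        ring
    _ = _ := by
        have x1 : exp (2 * k) * exp (E - 2 * k) = exp E := by rw [← Real.exp_add]; congr 1; ring
        have x2 : exp (2 * k) ^ 2 * exp (E - 4 * k) = exp E := by
          rw [← Real.exp_nat_mul, ← Real.exp_add]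
          congr 1
          push_cast
          ring
        rw [hNw, mul_pow]
        linear_combination (2 * Q + Q * E) * x1 + Q ^ 2 * (1 + E) * x2

theorem le_second_moment {k : ℕ} (hk : 0 < k) (hE : smallError k ≤ 1) :
    2 * (scaledCount k * exp (-smallError k)) +
        scaledCount k ^ 2 * exp (-smallError k) ^ 2 * (1 - smallError k) ^ 2 ≤
      ∑ t ∈ triples (2 ^ k * k) k, ∑ s ∈ triples (2 ^ k * k) k,
        cubeProb (fun ω => Occurs t ω ∧ Occurs s ω) := by
  obtain ⟨e1, e2, -, -, -⟩ := smallError_bounds hk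
  set E := smallError k with hEdef
  set n := 2 ^ k * k with hn
  set q : ℝ := (1 / 2) ^ k with hq
  set Q := scaledCount k with hQ
  have hq0 : 0 < q := by positivity
  set N : ℝ := ((triples n k).card : ℝ) with hN
  set w : ℝ := (1 / 2) ^ (2 * k + 1).choose 2 with hw
  have hNw : N * w = Q * exp (2 * k) := scaledCount_mul_exp k
  have hE0 : 0 ≤ 1 - E := sub_nonneg.mpr hE
  have hA : ∀ m, exp (-E - 2 * k) ≤ ((1 - q) ^ 2) ^ (n - m) := by
    intro m
    refine le_trans (Real.exp_le_exp.mpr ?_) (le_one_sub_sq_pow hk m)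
    change -E - 2 * k ≤ -(4 * k * q) - 2 * k
    nlinarith
  have hterm : ∀ t ∈ triples n k, 2 * (w * exp (-E - 2 * k)) +
      N * (1 - E) * (w ^ 2 * (1 - E) * exp (-E - 2 * k) ^ 2) ≤
      ∑ s ∈ triples n k, cubeProb (fun ω => Occurs t ω ∧ Occurs s ω) := by
    intro t ht
    refine le_trans ?_ (sum_cubeProb_occurs_two_ge hk ht (e1.trans hE))
    refine add_le_add ?_ ?_
    · rw [cubeProb_occurs hk ht]
      have := hA (2 * k + 1)
      gcongr
    · have := hA (2 * (2 * k + 1))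
      have h1 : 0 ≤ 1 - (2 * k + 1 : ℝ) ^ 2 / n := by linarith
      have h2 : 0 ≤ 1 - 4 * (2 * k + 1) * q := by linarith
      gcongr
  calc _ = 2 * ((N * w) * exp (-E - 2 * k)) +
        (N * w) ^ 2 * (1 - E) ^ 2 * exp (-E - 2 * k) ^ 2 := by
        have x1 : exp (2 * k) * exp (-E - 2 * k) = exp (-E) := by
          rw [← Real.exp_add]; congr 1; ring
        rw [hNw, ← x1]
        ring
    _ = ∑ t ∈ triples n k, (2 * (w * exp (-E - 2 * k)) +
      N * (1 - E) * (w ^ 2 * (1 - E) * exp (-E - 2 * k) ^ 2)) := by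
        rw [Finset.sum_const, nsmul_eq_mul]
        ring
    _ ≤ _ := Finset.sum_le_sum hterm

end SecondMoment

section Limit

theorem card_triples_mul_factorial_sq (n k : ℕ) :
    (triples n k).card * k.factorial ^ 2 = n.descFactorial (2 * k + 1) := by
  have h1 : (2 * k).choose k * k.factorial * k.factorial = (2 * k).factorial := by
    have := Nat.choose_mul_factorial_mul_factorial (show k ≤ 2 * k by omega)
    rwa [show 2 * k - k = k by omega] at this
  rw [card_triples, Nat.descFactorial_eq_factorial_mul_choose, Nat.factorial_succ, ← h1]
  ring

theorem scaledCount_eq {k : ℕ} (hk : 0 < k) :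
    scaledCount k = ((2 ^ k * k).descFactorial (2 * k + 1) : ℝ) /
      ((2 ^ k * k : ℕ) : ℝ) ^ (2 * k + 1) / (2 * Stirling.stirlingSeq k ^ 2) := by
  have hk' : (0 : ℝ) < k := by exact_mod_cast hk
  have hC : (2 * k + 1).choose 2 = k * (2 * k + 1) := by
    rw [Nat.choose_two_right]
    refine Nat.div_eq_of_eq_mul_left two_pos ?_
    rw [Nat.add_sub_cancel]
    ring
  have hs : Real.sqrt (2 * k) ^ 2 = 2 * k := Real.sq_sqrt (by positivity)
  have he : exp (-(2 * k)) = ((exp 1 ^ k) ^ 2)⁻¹ := by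
    rw [Real.exp_neg, ← pow_mul, ← Real.exp_nat_mul]
    congr 2
    push_cast
    ring
  have h2 : (0 : ℝ) < k.factorial := by exact_mod_cast k.factorial_pos
  rw [scaledCount, Stirling.stirlingSeq, ← card_triples_mul_factorial_sq, hC, he, pow_mul]
  push_cast
  simp only [div_pow, mul_pow, hs, one_pow]
  field_simp
  ring

theorem tendsto_descFactorial_div_pow :
    Tendsto (fun k : ℕ => ((2 ^ k * k).descFactorial (2 * k + 1) : ℝ) /
      ((2 ^ k * k : ℕ) : ℝ) ^ (2 * k + 1)) atTop (nhds 1) := by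
  have h0 : Tendsto (fun k => 1 - smallError k) atTop (nhds 1) := by
    simpa using tendsto_smallError.const_sub 1
  refine tendsto_of_tendsto_of_tendsto_of_le_of_le' h0 tendsto_const_nhds ?_ ?_
  · filter_upwards [eventually_gt_atTop 0, tendsto_smallError.eventually_le_const one_pos]
      with k hk hE
    obtain ⟨-, e2, -⟩ := smallError_bounds hk
    have hn : (0 : ℝ) < ((2 ^ k * k : ℕ) : ℝ) := by positivity
    generalize 2 ^ k * k = n at *
    have hmn : (2 * k + 1 : ℝ) ≤ n := by
      have h1 := e2.trans hE
      rw [div_le_one₀ hn] at h1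
      nlinarith [(Nat.cast_nonneg k : (0 : ℝ) ≤ k)]
    have h1 : ((n : ℝ) - (2 * k + 1)) ^ (2 * k + 1) ≤ n.descFactorial (2 * k + 1) := by
      have h2 : ((n + 1 - (2 * k + 1) : ℕ) : ℝ) ^ (2 * k + 1) ≤ n.descFactorial (2 * k + 1) := by
        exact_mod_cast Nat.pow_sub_le_descFactorial n (2 * k + 1)
      refine le_trans (pow_le_pow_left₀ (by linarith) ?_ _) h2
      rw [sub_le_iff_le_add]
      exact_mod_cast (by omega : n ≤ (n + 1 - (2 * k + 1)) + (2 * k + 1))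
    calc 1 - smallError k ≤ 1 + ((2 * k + 1 : ℕ) : ℝ) * (-((2 * k + 1) / n)) := by
          push_cast
          have : (2 * k + 1 : ℝ) * (-((2 * k + 1) / n)) = -((2 * k + 1) ^ 2 / n) := by ring
          linarith
      _ ≤ (1 + -((2 * k + 1) / n)) ^ (2 * k + 1) := by
          refine one_add_mul_le_pow ?_ _
          have := (div_le_one₀ hn).mpr hmn
          linarith
      _ = ((n : ℝ) - (2 * k + 1)) ^ (2 * k + 1) / n ^ (2 * k + 1) := by
          rw [← div_pow, sub_div, div_self hn.ne', sub_eq_add_neg]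
      _ ≤ _ := by gcongr
  · filter_upwards with k
    refine div_le_one_of_le₀ ?_ (by positivity)
    exact_mod_cast Nat.descFactorial_le_pow _ _

theorem tendsto_scaledCount : Tendsto scaledCount atTop (nhds (1 / (2 * π))) := by
  have h1 := (Stirling.tendsto_stirlingSeq_sqrt_pi.pow 2).const_mul 2
  rw [Real.sq_sqrt Real.pi_pos.le] at h1
  refine (tendsto_descFactorial_div_pow.div h1 (by positivity)).congr' ?_
  filter_upwards [eventually_gt_atTop 0] with k hk
  exact (scaledCount_eq hk).symm

end Limit

/-- With `n_k = 2^k k` and `X̃(k,k) = X(k,k)/2`,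
`E[X̃(k,k)²] → 1/(4π) + 1/(16π²)` as `k → ∞`. -/
theorem second_moment_tendsto :
    Tendsto (fun k : ℕ =>
        expect (2 ^ k * k) (fun G => ((Xcount (2 ^ k * k) k k G : ℝ) / 2) ^ 2))
      atTop (nhds (1 / (4 * Real.pi) + 1 / (16 * Real.pi ^ 2))) := by
  have hQ := tendsto_scaledCount
  have hE := tendsto_smallError
  have hexp : Tendsto (fun k => exp (smallError k)) atTop (nhds 1) := by
    simpa [Function.comp_def] using (Real.continuous_exp.tendsto 0).comp hE
  have hexp' : Tendsto (fun k => exp (-smallError k)) atTop (nhds 1) := by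
    have h0 := hE.neg
    rw [neg_zero] at h0
    simpa [Function.comp_def] using (Real.continuous_exp.tendsto 0).comp h0
  have hval : 1 / 4 * (2 * (1 / (2 * π)) + (1 / (2 * π)) ^ 2) =
      1 / (4 * π) + 1 / (16 * π ^ 2) := by
    field_simp
    ring
  rw [← hval]
  simp_rw [expect_sq]
  refine Tendsto.const_mul _ (tendsto_of_tendsto_of_tendsto_of_le_of_le'
    (g := fun k => 2 * (scaledCount k * exp (-smallError k)) +
      scaledCount k ^ 2 * exp (-smallError k) ^ 2 * (1 - smallError k) ^ 2)
    (h := fun k => 2 * (scaledCount k * exp (smallError k)) +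
        scaledCount k ^ 2 * exp (smallError k) * (1 + smallError k) +
        scaledCount k * exp (smallError k) * smallError k) ?_ ?_ ?_ ?_)
  · simpa using ((hQ.mul hexp').const_mul 2).add
      (((hQ.pow 2).mul (hexp'.pow 2)).mul ((hE.const_sub 1).pow 2))
  · simpa using (((hQ.mul hexp).const_mul 2).add
      (((hQ.pow 2).mul hexp).mul (hE.const_add 1))).add ((hQ.mul hexp).mul hE)
  · filter_upwards [eventually_gt_atTop 0, hE.eventually_le_const one_pos] with k hk hk1
    exact le_second_moment hk hk1
  · filter_upwards [eventually_gt_atTop 0, hE.eventually_le_const one_pos] with k hk hk1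
    exact second_moment_le hk hk1
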